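/- Let n > 10 be an integer, p > p_c and α > 0. Suppose v₀ : ℝⁿ → ℝ is continuous, satisfies 0 ≤ v₀(x) ≤ L|x|^{-ν} for all x ≠ 0, and |v₀(x) − φ_α(|x|)| ≤ b|x|^{-γ} for all |x| > 1, where b > 0 and γ ∈ (ν+λ₁, (n−2)/2). Then for every bounded classical solution v of (v^p)_t = Δv + v^p on ℝⁿ with initial data v₀ there exists C > 0 such that |v(x,t) − φ_α(|x|)| ≤ C e^{−κ(γ) t} for all x ∈ ℝⁿ and t ≥ 0. -/

import Mathlib

noncomputable section

open Real Filter Set Asymptotics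

/-- `ν = 2/(p-1)`. -/
def nuExp (p : ℝ) : ℝ := 2 / (p - 1)

/-- `L = (ν(n−2−ν))^{1/(p−1)}`. -/
def Lconst (n : ℕ) (p : ℝ) : ℝ := (nuExp p * ((n : ℝ) - 2 - nuExp p)) ^ (1 / (p - 1))

/-- The critical exponent `p_c` for `n > 10`. -/
def pc (n : ℕ) : ℝ :=
  (((n : ℝ) - 2) ^ 2 - 4 * (n : ℝ) + 8 * Real.sqrt ((n : ℝ) - 1)) /
    (((n : ℝ) - 2) * ((n : ℝ) - 10))

/-- `λ₁ = (n−2−2ν − √((n−2−2ν)² − 8(n−2−ν)))/2`. -/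
def lam1 (n : ℕ) (p : ℝ) : ℝ :=
  (((n : ℝ) - 2 - 2 * nuExp p) -
    Real.sqrt (((n : ℝ) - 2 - 2 * nuExp p) ^ 2 - 8 * ((n : ℝ) - 2 - nuExp p))) / 2

/-- `κ(γ) = γ(n−2−γ)/(pL^{p−1}) − 1`. -/
def kappaOf (n : ℕ) (p γ : ℝ) : ℝ :=
  γ * ((n : ℝ) - 2 - γ) / (p * Lconst n p ^ (p - 1)) - 1

/-- `φ` is the (radial profile of the) positive steady state `φ_α` of `Δφ + φ^p = 0`
with `φ(0) = α`, `φ'(0) = 0`, together with its properties in the supercritical range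
`n > 10`, `p > p_c`: positivity, strict monotonicity, the bound `φ(r) ≤ L r^{−ν}`, and the
asymptotic expansion `φ(r) = L r^{−ν} − a r^{−ν−λ₁} + o(r^{−ν−λ₁})` with coefficient `a > 0`. -/
structure IsSteadyStateA (n : ℕ) (p α : ℝ) (φ : ℝ → ℝ) (a : ℝ) : Prop where
  cont : ContinuousOn φ (Set.Ici 0)
  smooth : ContDiffOn ℝ 2 φ (Set.Ioi 0)
  ode : ∀ r > (0 : ℝ), deriv (deriv φ) r + ((n : ℝ) - 1) / r * deriv φ r + φ r ^ p = 0
  val0 : φ 0 = α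
  deriv0 : derivWithin φ (Set.Ici 0) 0 = 0
  pos : ∀ r ≥ (0 : ℝ), 0 < φ r
  anti : StrictAntiOn φ (Set.Ici 0)
  upper : ∀ r > (0 : ℝ), φ r ≤ Lconst n p * r ^ (-nuExp p)
  a_pos : 0 < a
  expansion :
    (fun r => φ r - (Lconst n p * r ^ (-nuExp p) - a * r ^ (-nuExp p - lam1 n p)))
      =o[atTop] fun r => r ^ (-nuExp p - lam1 n p)

/-- The Laplacian of `f : ℝⁿ → ℝ` at `x`, as the sum of second partial derivatives. -/
def lap (n : ℕ) (f : EuclideanSpace ℝ (Fin n) → ℝ) (x : EuclideanSpace ℝ (Fin n)) : ℝ :=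
  ∑ i : Fin n, fderiv ℝ (fun y => fderiv ℝ f y (EuclideanSpace.single i 1)) x
    (EuclideanSpace.single i 1)

/-- `v` is a bounded classical solution of `(v^p)_t = Δv + v^p` on `ℝⁿ × (0,∞)` with
initial data `v₀`: nonnegative, continuous on `ℝⁿ × [0,∞)`, bounded on `ℝⁿ × [0,T]` for
every `T > 0`, twice continuously differentiable in `x` and once (continuously) in `t` for
`t > 0`, satisfying the equation pointwise, and attaining the initial data. -/
structure IsBddClassicalSol (n : ℕ) (p : ℝ) (v : EuclideanSpace ℝ (Fin n) → ℝ → ℝ)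
    (v₀ : EuclideanSpace ℝ (Fin n) → ℝ) : Prop where
  nonneg : ∀ x, ∀ t ≥ (0 : ℝ), 0 ≤ v x t
  cont : ContinuousOn (fun q : EuclideanSpace ℝ (Fin n) × ℝ => v q.1 q.2)
    ((Set.univ : Set (EuclideanSpace ℝ (Fin n))) ×ˢ Set.Ici (0 : ℝ))
  bdd : ∀ T > (0 : ℝ), ∃ M, ∀ x, ∀ t ∈ Set.Icc (0 : ℝ) T, v x t ≤ M
  smooth_space : ∀ t > (0 : ℝ), ContDiff ℝ 2 fun x => v x t
  smooth_time : ∀ x, ContDiffOn ℝ 1 (fun s => v x s ^ p) (Set.Ioi (0 : ℝ))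
  pde : ∀ x, ∀ t > (0 : ℝ),
    deriv (fun s => v x s ^ p) t = lap n (fun y => v y t) x + v x t ^ p
  init : ∀ x, v x 0 = v₀ x


abbrev EE (n : ℕ) := EuclideanSpace ℝ (Fin n)

/-- `g` is twice differentiable on `(0,∞)` and its radial Laplacian is `h`. -/
def RadLap (n : ℕ) (g h : ℝ → ℝ) : Prop :=
  ∃ g1 : ℝ → ℝ, (∀ r > 0, HasDerivAt g (g1 r) r) ∧
    (∀ r > 0, HasDerivAt g1 (h r - ((n : ℝ) - 1) / r * g1 r) r)

lemma second_deriv_nonpos {g g1 : ℝ → ℝ} {c s0 : ℝ}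
    (h1 : ∀ᶠ s in nhds s0, HasDerivAt g (g1 s) s) (h2 : HasDerivAt g1 c s0)
    (hmax : IsLocalMax g s0) : c ≤ 0 := by
  by_contra hc
  push Not at hc
  have e1 : deriv g =ᶠ[nhds s0] g1 := h1.mono fun s hs => hs.deriv
  have e2 : deriv (deriv g) s0 = c := by rw [e1.deriv_eq]; exact h2.deriv
  have e3 : deriv g s0 = 0 := hmax.deriv_eq_zero
  have hmin : IsLocalMin g s0 :=
    isLocalMin_of_deriv_deriv_pos (by rw [e2]; exact hc) e3 h1.self_of_nhds.continuousAt
  have hconst : g =ᶠ[nhds s0] fun _ => g s0 := by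
    filter_upwards [hmax, hmin] with s a b
    exact le_antisymm a b
  have e4 : deriv g =ᶠ[nhds s0] fun _ => 0 := by
    have := hconst.deriv
    simpa using this
  have : deriv (deriv g) s0 = 0 := by rw [e4.deriv_eq]; simp
  linarith

lemma norm_line {n : ℕ} (x : EE n) (i : Fin n) (s : ℝ) :
    ‖x + s • EuclideanSpace.single i (1:ℝ)‖ = Real.sqrt (‖x‖ ^ 2 + 2 * s * x i + s ^ 2) := by
  rw [eq_comm, Real.sqrt_eq_iff_eq_sq, norm_add_sq_real]
  · simp [inner_smul_right, EuclideanSpace.inner_single_right, norm_smul]; ring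
  · have : ‖x‖ ^ 2 + 2 * s * x i + s ^ 2 = ‖x + s • EuclideanSpace.single i (1:ℝ)‖ ^ 2 := by
      rw [norm_add_sq_real]
      simp [inner_smul_right, EuclideanSpace.inner_single_right, norm_smul]; ring
    rw [this]; positivity
  · positivity

lemma lap_le_of_max {n : ℕ} {v : EE n → ℝ} (hv : ContDiff ℝ 2 v) {g h : ℝ → ℝ}
    (hg : RadLap n g h) {x : EE n} (hx : 0 < ‖x‖)
    (hmax : IsLocalMax (fun y => v y - g ‖y‖) x) : lap n v x ≤ h ‖x‖ := by
  obtain ⟨g1, hg1, hg2⟩ := hg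
  set r := ‖x‖ with hr
  have key : ∀ i : Fin n, fderiv ℝ (fun y => fderiv ℝ v y (EuclideanSpace.single i 1)) x
      (EuclideanSpace.single i 1) ≤ (h r - ((n : ℝ) - 1) / r * g1 r) * (x i / r) ^ 2
        + g1 r * (1 / r - x i ^ 2 / r ^ 3) := by
    intro i
    set e : EE n := EuclideanSpace.single i 1 with he
    have hline : ∀ s : ℝ, HasDerivAt (fun s : ℝ => x + s • e) e s := by
      intro s
      simpa using ((hasDerivAt_id s).smul_const e).const_add x
    have hρ : ∀ s : ℝ, 0 < ‖x + s • e‖ →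
        HasDerivAt (fun s : ℝ => ‖x + s • e‖) ((x i + s) / ‖x + s • e‖) s := by
      intro s hs
      have e0 : (fun s : ℝ => ‖x + s • e‖) = fun s => Real.sqrt (r ^ 2 + 2 * s * x i + s ^ 2) := by
        funext s; exact norm_line x i s
      have hs' := norm_line x i s
      rw [← he] at hs'
      rw [e0, hs']
      rw [hs', Real.sqrt_pos] at hs
      have h0 : HasDerivAt (fun s : ℝ => r ^ 2 + 2 * s * x i + s ^ 2) (2 * x i + 2 * s) s := by
        have a1 := (((hasDerivAt_id s).const_mul 2).mul_const (x i)).const_add (r ^ 2)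
        have a2 := (hasDerivAt_id s).pow 2
        have := a1.add a2
        refine this.congr_deriv ?_
        simp
      refine (h0.sqrt hs.ne').congr_deriv ?_
      rw [← mul_add, mul_div_mul_left _ _ two_ne_zero]
    have hev : ∀ᶠ s : ℝ in nhds 0, 0 < ‖x + s • e‖ := by
      have : ContinuousAt (fun s : ℝ => ‖x + s • e‖) 0 := by fun_prop
      apply this.eventually
      apply lt_mem_nhds
      simp only [zero_smul, add_zero]; exact hx
    have hvd : Differentiable ℝ v := hv.differentiable (by norm_num)
    have hvd2 : Differentiable ℝ (fun y => fderiv ℝ v y e) := by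
      have : ContDiff ℝ 1 (fderiv ℝ v) := hv.fderiv_right (by norm_num)
      exact (this.differentiable (by norm_num)).clm_apply (differentiable_const e)
    have A1 : ∀ᶠ s : ℝ in nhds 0, HasDerivAt
        (fun s : ℝ => v (x + s • e) - g ‖x + s • e‖)
        (fderiv ℝ v (x + s • e) e - g1 ‖x + s • e‖ * ((x i + s) / ‖x + s • e‖)) s := by
      filter_upwards [hev] with s hs
      have b1 := (hvd (x + s • e)).hasFDerivAt.comp_hasDerivAt s (hline s)
      have b2 := (hg1 _ hs).comp s (hρ s hs)
      exact b1.sub b2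
    have hx0 : x + (0:ℝ) • e = x := by simp
    have h00 : 0 < ‖x + (0:ℝ) • e‖ := by rw [hx0]; exact hx
    have A2 : HasDerivAt
        (fun s : ℝ => fderiv ℝ v (x + s • e) e - g1 ‖x + s • e‖ * ((x i + s) / ‖x + s • e‖))
        (fderiv ℝ (fun y => fderiv ℝ v y e) x e -
          ((h r - ((n : ℝ) - 1) / r * g1 r) * (x i / r) ^ 2
        + g1 r * (1 / r - x i ^ 2 / r ^ 3))) 0 := by
      have b1 := (hvd2 (x + (0:ℝ) • e)).hasFDerivAt.comp_hasDerivAt 0 (hline 0)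
      have b2 := (hg2 _ h00).comp 0 (hρ 0 h00)
      have b3 := ((hasDerivAt_id (0:ℝ)).const_add (x i)).div (hρ 0 h00) h00.ne'
      have := b1.sub (b2.mul b3)
      refine this.congr_deriv ?_
      simp only [hx0, ← hr, add_zero, id, Function.comp, Pi.div_apply]
      field_simp
    have A3 : IsLocalMax (fun s : ℝ => v (x + s • e) - g ‖x + s • e‖) 0 := by
      have hc : ContinuousAt (fun s : ℝ => x + s • e) 0 := by fun_prop
      have hc' : Tendsto (fun s : ℝ => x + s • e) (nhds 0) (nhds x) := by
        simpa [ContinuousAt] using hc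
      have := hc'.eventually hmax
      simpa [IsLocalMax, IsMaxFilter] using this
    have := second_deriv_nonpos A1 A2 A3
    linarith
  unfold lap
  refine (Finset.sum_le_sum fun i _ => key i).trans (le_of_eq ?_)
  have hsum : ∑ i : Fin n, x i ^ 2 = r ^ 2 := by
    rw [hr, EuclideanSpace.norm_sq_eq]; simp
  rw [Finset.sum_add_distrib, ← Finset.mul_sum, ← Finset.mul_sum, Finset.sum_sub_distrib]
  simp only [div_pow]
  simp only [← Finset.sum_div, hsum]
  simp only [Finset.sum_const, Finset.card_univ, Fintype.card_fin, nsmul_eq_mul]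
  field_simp
  ring

lemma lap_neg {n : ℕ} (v : EE n → ℝ) (x : EE n) : lap n (fun y => - v y) x = - lap n v x := by
  unfold lap
  rw [← Finset.sum_neg_distrib]
  refine Finset.sum_congr rfl fun i _ => ?_
  have : (fun y => fderiv ℝ (fun y => - v y) y (EuclideanSpace.single i (1:ℝ))) =
      fun y => - (fderiv ℝ v y (EuclideanSpace.single i (1:ℝ))) := by
    funext y
    rw [fderiv_fun_neg]; rfl
  rw [this, fderiv_fun_neg]; rfl

lemma RadLap.neg {n : ℕ} {g h : ℝ → ℝ} (hg : RadLap n g h) :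
    RadLap n (fun r => - g r) (fun r => - h r) := by
  obtain ⟨g1, a, b⟩ := hg
  refine ⟨fun r => - g1 r, fun r hr => (a r hr).neg, fun r hr => ?_⟩
  refine (b r hr).neg.congr_deriv ?_; ring

lemma RadLap.add {n : ℕ} {g h g' h' : ℝ → ℝ} (hg : RadLap n g h) (hg' : RadLap n g' h') :
    RadLap n (fun r => g r + g' r) (fun r => h r + h' r) := by
  obtain ⟨g1, a, b⟩ := hg
  obtain ⟨g1', a', b'⟩ := hg'
  refine ⟨fun r => g1 r + g1' r, fun r hr => (a r hr).add (a' r hr), fun r hr => ?_⟩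
  refine ((b r hr).add (b' r hr)).congr_deriv ?_; ring

lemma RadLap.mul {n : ℕ} {g h : ℝ → ℝ} (c : ℝ) (hg : RadLap n g h) :
    RadLap n (fun r => c * g r) (fun r => c * h r) := by
  obtain ⟨g1, a, b⟩ := hg
  refine ⟨fun r => c * g1 r, fun r hr => (a r hr).const_mul c, fun r hr => ?_⟩
  refine ((b r hr).const_mul c).congr_deriv ?_; ring

lemma RadLap.cont {n : ℕ} {g h : ℝ → ℝ} (hg : RadLap n g h) : ContinuousOn g (Ioi 0) := by
  obtain ⟨g1, a, b⟩ := hg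
  exact fun r hr => (a r hr).continuousAt.continuousWithinAt

lemma lap_ge_of_min {n : ℕ} {v : EE n → ℝ} (hv : ContDiff ℝ 2 v) {g h : ℝ → ℝ}
    (hg : RadLap n g h) {x : EE n} (hx : 0 < ‖x‖)
    (hmin : IsLocalMin (fun y => v y - g ‖y‖) x) : h ‖x‖ ≤ lap n v x := by
  have h1 : IsLocalMax (fun y => - v y - - g ‖y‖) x := by
    filter_upwards [hmin] with y hy
    linarith
  have := lap_le_of_max hv.neg hg.neg hx h1
  have h2 := lap_neg v x
  linarith

lemma first_touch {X : Type*} [TopologicalSpace X] [T2Space X] (F : X → ℝ → ℝ) (D K : Set X) (T : ℝ)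
    (hK : IsCompact K) (hKD : K ⊆ D)
    (hF : ContinuousOn (fun q : X × ℝ => F q.1 q.2) (D ×ˢ Icc 0 T))
    (h0 : ∀ x ∈ D, F x 0 < 0)
    (hout : ∀ x ∈ D, x ∉ K → ∀ t ∈ Icc 0 T, F x t < 0)
    (hcontra : ∀ x ∈ D, ∀ t ∈ Ioc 0 T, F x t = 0 →
      (∀ y ∈ D, ∀ s ∈ Icc 0 t, F y s ≤ 0) → False) :
    ∀ x ∈ D, ∀ t ∈ Icc 0 T, F x t < 0 := by
  by_contra hne
  push Not at hne
  obtain ⟨x₁, hx₁, t₁, ht₁, hF₁⟩ := hne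
  set S : Set (X × ℝ) := (K ×ˢ Icc 0 T) ∩ (fun q : X × ℝ => F q.1 q.2) ⁻¹' (Ici 0) with hS
  have hKT : IsCompact (K ×ˢ Icc (0:ℝ) T) := hK.prod isCompact_Icc
  have hFK : ContinuousOn (fun q : X × ℝ => F q.1 q.2) (K ×ˢ Icc 0 T) :=
    hF.mono (prod_mono hKD subset_rfl)
  have hSc : IsCompact S :=
    hKT.of_isClosed_subset (hFK.preimage_isClosed_of_isClosed hKT.isClosed isClosed_Ici)
      inter_subset_left
  have memS : ∀ x ∈ D, ∀ t ∈ Icc 0 T, 0 ≤ F x t → (x, t) ∈ S := by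
    intro x hx t ht h
    refine ⟨⟨?_, ht⟩, h⟩
    by_contra hxK
    exact absurd (hout x hx hxK t ht) (not_lt.mpr h)
  obtain ⟨⟨x₀, t₀⟩, hm, hmin⟩ := hSc.exists_isMinOn ⟨_, memS x₁ hx₁ t₁ ht₁ hF₁⟩
    (f := fun q : X × ℝ => q.2) continuous_snd.continuousOn
  have hx₀ : x₀ ∈ D := hKD hm.1.1
  have ht₀ : t₀ ∈ Icc 0 T := hm.1.2
  have hF₀ : 0 ≤ F x₀ t₀ := hm.2
  have hpos : 0 < t₀ := by
    rcases ht₀.1.lt_or_eq with h | h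
    · exact h
    · have := h0 x₀ hx₀
      rw [← h] at hF₀
      linarith
  have hlt : ∀ y ∈ D, ∀ s ∈ Icc 0 T, s < t₀ → F y s < 0 := by
    intro y hy s hs hst
    by_contra hcon
    push Not at hcon
    have := hmin (memS y hy s hs hcon)
    simp only [mem_ofPred_eq] at this
    linarith
  have hle : ∀ y ∈ D, F y t₀ ≤ 0 := by
    intro y hy
    have hc : ContinuousOn (fun s => F y s) (Icc 0 T) :=
      hF.comp (f := fun s : ℝ => (y, s)) (by fun_prop) (fun s hs => ⟨hy, hs⟩)
    have hc' : Tendsto (fun s => F y s) (nhdsWithin t₀ (Ioo 0 t₀)) (nhds (F y t₀)) :=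
      ((hc t₀ ht₀).mono (fun s hs => ⟨hs.1.le, hs.2.le.trans ht₀.2⟩))
    have : (nhdsWithin t₀ (Ioo 0 t₀)).NeBot := by
      rw [nhdsWithin_Ioo_eq_nhdsLT hpos]; infer_instance
    refine le_of_tendsto hc' ?_
    filter_upwards [self_mem_nhdsWithin] with s hs
    exact (hlt y hy s ⟨hs.1.le, hs.2.le.trans ht₀.2⟩ hs.2).le
  refine hcontra x₀ hx₀ t₀ ⟨hpos, ht₀.2⟩ (le_antisymm (hle x₀ hx₀) hF₀) ?_
  intro y hy s hs
  rcases hs.2.lt_or_eq with h | h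
  · exact (hlt y hy s ⟨hs.1, hs.2.trans ht₀.2⟩ h).le
  · rw [h]; exact hle y hy

lemma deriv_nonneg_of_left {G : ℝ → ℝ} {G' t : ℝ} (hG : HasDerivAt G G' t)
    (h : ∀ᶠ s in nhdsWithin t (Iio t), G s ≤ G t) : 0 ≤ G' := by
  have h1 := (hasDerivAt_iff_tendsto_slope.1 hG).mono_left
    (nhdsWithin_mono t (fun s (hs : s ∈ Iio t) => ne_of_lt hs))
  refine ge_of_tendsto h1 ?_
  filter_upwards [h, self_mem_nhdsWithin] with s hs hst
  rw [slope_def_field]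
  have : s < t := hst
  exact div_nonneg_of_nonpos (by linarith) (by linarith)

lemma norm_shell_compact {n : ℕ} (c d : ℝ) : IsCompact {x : EE n | ‖x‖ ∈ Icc c d} := by
  refine Metric.isCompact_of_isClosed_isBounded (isClosed_Icc.preimage continuous_norm) ?_
  refine (Metric.isBounded_closedBall (x := (0 : EE n)) (r := d)).subset ?_
  intro x hx
  simpa using hx.2

lemma sol_hasDeriv {n : ℕ} {p : ℝ} {v : EE n → ℝ → ℝ} {v₀ : EE n → ℝ}
    (hv : IsBddClassicalSol n p v v₀) (x : EE n) {t : ℝ} (ht : 0 < t) :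
    HasDerivAt (fun s => v x s ^ p) (lap n (fun y => v y t) x + v x t ^ p) t := by
  rw [← hv.pde x t ht]
  have := (hv.smooth_time x).differentiableOn (by norm_num) t ht
  exact (this.differentiableAt (Ioi_mem_nhds ht)).hasDerivAt

lemma barrier_cont {n : ℕ} {v : EE n → ℝ → ℝ} {I : Set ℝ} {T : ℝ} (hI : I ⊆ Ioi 0)
    (hv : ContinuousOn (fun q : EE n × ℝ => v q.1 q.2) (univ ×ˢ Ici (0 : ℝ)))
    {ζ g1 g2 : ℝ → ℝ} (hζ : ContinuousOn ζ (Ioi 0)) (hg1 : ContinuousOn g1 (Ioi 0))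
    (hg2 : ContinuousOn g2 (Ioi 0)) (k1 k2 : ℝ) :
    ContinuousOn (fun q : EE n × ℝ => v q.1 q.2 -
      (ζ ‖q.1‖ + (Real.exp (k1 * q.2) * g1 ‖q.1‖ + Real.exp (k2 * q.2) * g2 ‖q.1‖)))
      ({x : EE n | ‖x‖ ∈ I} ×ˢ Icc 0 T) := by
  have hn : ∀ {g : ℝ → ℝ}, ContinuousOn g (Ioi 0) →
      ContinuousOn (fun q : EE n × ℝ => g ‖q.1‖) ({x : EE n | ‖x‖ ∈ I} ×ˢ Icc 0 T) := by
    intro g hg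
    exact hg.comp (f := fun q : EE n × ℝ => ‖q.1‖) (by fun_prop) (fun q hq => hI hq.1)
  have h1 : ContinuousOn (fun q : EE n × ℝ => v q.1 q.2) ({x : EE n | ‖x‖ ∈ I} ×ˢ Icc 0 T) :=
    hv.mono (prod_mono (subset_univ _) Icc_subset_Ici_self)
  have a0 := hn hζ
  have a1 := hn hg1
  have a2 := hn hg2
  have b : ∀ k : ℝ, Continuous (fun q : EE n × ℝ => Real.exp (k * q.2)) := fun k => by fun_prop
  exact h1.sub (a0.add (((b k1).continuousOn.mul a1).add ((b k2).continuousOn.mul a2)))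

lemma barrier_time (ζ a b k1 k2 t : ℝ) :
    HasDerivAt (fun s : ℝ => ζ + (Real.exp (k1 * s) * a + Real.exp (k2 * s) * b))
      (k1 * (Real.exp (k1 * t) * a) + k2 * (Real.exp (k2 * t) * b)) t := by
  have h : ∀ k : ℝ, HasDerivAt (fun s : ℝ => Real.exp (k * s)) (Real.exp (k * t) * (k * 1)) t :=
    fun k => ((hasDerivAt_id t).const_mul k).exp
  refine ((((h k1).mul_const a).add ((h k2).mul_const b)).const_add ζ).congr_deriv ?_
  ring

theorem cmp_upper {n : ℕ} {p : ℝ} (hp : 1 < p) {v : EE n → ℝ → ℝ} {v₀ : EE n → ℝ}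
    (hv : IsBddClassicalSol n p v v₀) {T : ℝ} {I : Set ℝ} (hIo : IsOpen I) (hI : I ⊆ Ioi 0)
    (c d : ℝ) (hcd : Icc c d ⊆ I) {ζ hζ g1 h1 g2 h2 : ℝ → ℝ} (Rζ : RadLap n ζ hζ)
    (R1 : RadLap n g1 h1) (R2 : RadLap n g2 h2) (k1 k2 : ℝ)
    (h0 : ∀ x : EE n, ‖x‖ ∈ I → v₀ x < ζ ‖x‖ + (g1 ‖x‖ + g2 ‖x‖))
    (hout : ∀ x : EE n, ‖x‖ ∈ I → ‖x‖ ∉ Icc c d → ∀ t ∈ Icc 0 T,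
      v x t < ζ ‖x‖ + (Real.exp (k1 * t) * g1 ‖x‖ + Real.exp (k2 * t) * g2 ‖x‖))
    (hineq : ∀ x : EE n, ‖x‖ ∈ I → ∀ t ∈ Ioc 0 T,
      v x t = ζ ‖x‖ + (Real.exp (k1 * t) * g1 ‖x‖ + Real.exp (k2 * t) * g2 ‖x‖) →
      hζ ‖x‖ + (Real.exp (k1 * t) * h1 ‖x‖ + Real.exp (k2 * t) * h2 ‖x‖) + v x t ^ p <
      p * v x t ^ (p - 1) *
        (k1 * (Real.exp (k1 * t) * g1 ‖x‖) + k2 * (Real.exp (k2 * t) * g2 ‖x‖))) :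
    ∀ x : EE n, ‖x‖ ∈ I → ∀ t ∈ Icc 0 T,
      v x t < ζ ‖x‖ + (Real.exp (k1 * t) * g1 ‖x‖ + Real.exp (k2 * t) * g2 ‖x‖) := by
  have main := first_touch (fun (x : EE n) t => v x t -
      (ζ ‖x‖ + (Real.exp (k1 * t) * g1 ‖x‖ + Real.exp (k2 * t) * g2 ‖x‖)))
      {x : EE n | ‖x‖ ∈ I} {x : EE n | ‖x‖ ∈ Icc c d} T (norm_shell_compact c d)
      (fun x hx => hcd hx) (barrier_cont hI hv.cont Rζ.cont R1.cont R2.cont k1 k2)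
      (fun x hx => by have := h0 x hx; simp only [mul_zero, Real.exp_zero, one_mul, hv.init]; linarith)
      (fun x hx hxK t ht => by have := hout x hx hxK t ht; linarith) ?_
  · intro x hx t ht
    have := main x hx t ht
    linarith
  intro x hx t ht heq hle
  have heq' : v x t = ζ ‖x‖ + (Real.exp (k1 * t) * g1 ‖x‖ + Real.exp (k2 * t) * g2 ‖x‖) := by
    linarith
  have hpos : 0 < ‖x‖ := hI hx
  have hineq' := hineq x hx t ht heq'
  have hnhd : {x : EE n | ‖x‖ ∈ I} ∈ nhds x := (hIo.preimage continuous_norm).mem_nhds hx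
  have hlap : lap n (fun y => v y t) x ≤
      hζ ‖x‖ + (Real.exp (k1 * t) * h1 ‖x‖ + Real.exp (k2 * t) * h2 ‖x‖) := by
    refine lap_le_of_max (hv.smooth_space t ht.1)
      (Rζ.add ((R1.mul (Real.exp (k1 * t))).add (R2.mul (Real.exp (k2 * t))))) hpos ?_
    filter_upwards [hnhd] with y hy
    have := hle y hy t ⟨ht.1.le, le_rfl⟩
    linarith
  have hd1 := sol_hasDeriv hv x ht.1
  have hd2 := (barrier_time (ζ ‖x‖) (g1 ‖x‖) (g2 ‖x‖) k1 k2 t).rpow_const (p := p) (Or.inr hp.le)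
  rw [← heq'] at hd2
  have hd := hd1.sub hd2
  have := deriv_nonneg_of_left hd (by
    have : Ioo 0 t ∈ nhdsWithin t (Iio t) := Ioo_mem_nhdsLT ht.1
    filter_upwards [this] with s hs
    have hle1 := hle x hx s ⟨hs.1.le, hs.2.le⟩
    have : v x s ^ p ≤ (ζ ‖x‖ + (Real.exp (k1 * s) * g1 ‖x‖ + Real.exp (k2 * s) * g2 ‖x‖)) ^ p :=
      Real.rpow_le_rpow (hv.nonneg x s hs.1.le) (by linarith) (by linarith)
    simp only [Pi.sub_apply]
    rw [← heq']
    linarith)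
  nlinarith

theorem cmp_lower {n : ℕ} {p : ℝ} (hp : 1 < p) {v : EE n → ℝ → ℝ} {v₀ : EE n → ℝ}
    (hv : IsBddClassicalSol n p v v₀) {T : ℝ} {I : Set ℝ} (hIo : IsOpen I) (hI : I ⊆ Ioi 0)
    (c d : ℝ) (hcd : Icc c d ⊆ I) {ζ hζ g1 h1 g2 h2 : ℝ → ℝ} (Rζ : RadLap n ζ hζ)
    (R1 : RadLap n g1 h1) (R2 : RadLap n g2 h2) (k1 k2 : ℝ)
    (h0 : ∀ x : EE n, ‖x‖ ∈ I → ζ ‖x‖ + (g1 ‖x‖ + g2 ‖x‖) < v₀ x)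
    (hout : ∀ x : EE n, ‖x‖ ∈ I → ‖x‖ ∉ Icc c d → ∀ t ∈ Icc 0 T,
      ζ ‖x‖ + (Real.exp (k1 * t) * g1 ‖x‖ + Real.exp (k2 * t) * g2 ‖x‖) < v x t)
    (hineq : ∀ x : EE n, ‖x‖ ∈ I → ∀ t ∈ Ioc 0 T,
      v x t = ζ ‖x‖ + (Real.exp (k1 * t) * g1 ‖x‖ + Real.exp (k2 * t) * g2 ‖x‖) →
      p * v x t ^ (p - 1) *
        (k1 * (Real.exp (k1 * t) * g1 ‖x‖) + k2 * (Real.exp (k2 * t) * g2 ‖x‖)) <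
      hζ ‖x‖ + (Real.exp (k1 * t) * h1 ‖x‖ + Real.exp (k2 * t) * h2 ‖x‖) + v x t ^ p) :
    ∀ x : EE n, ‖x‖ ∈ I → ∀ t ∈ Icc 0 T,
      ζ ‖x‖ + (Real.exp (k1 * t) * g1 ‖x‖ + Real.exp (k2 * t) * g2 ‖x‖) < v x t := by
  have main := first_touch (fun (x : EE n) t => - (v x t -
      (ζ ‖x‖ + (Real.exp (k1 * t) * g1 ‖x‖ + Real.exp (k2 * t) * g2 ‖x‖))))
      {x : EE n | ‖x‖ ∈ I} {x : EE n | ‖x‖ ∈ Icc c d} T (norm_shell_compact c d)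
      (fun x hx => hcd hx) (barrier_cont hI hv.cont Rζ.cont R1.cont R2.cont k1 k2).neg
      (fun x hx => by have := h0 x hx; simp only [mul_zero, Real.exp_zero, one_mul, hv.init]; linarith)
      (fun x hx hxK t ht => by have := hout x hx hxK t ht; linarith) ?_
  · intro x hx t ht
    have := main x hx t ht
    linarith
  intro x hx t ht heq hle
  have heq' : v x t = ζ ‖x‖ + (Real.exp (k1 * t) * g1 ‖x‖ + Real.exp (k2 * t) * g2 ‖x‖) := by
    linarith
  have hpos : 0 < ‖x‖ := hI hx
  have hineq' := hineq x hx t ht heq'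
  have hnhd : {x : EE n | ‖x‖ ∈ I} ∈ nhds x := (hIo.preimage continuous_norm).mem_nhds hx
  have hlap : hζ ‖x‖ + (Real.exp (k1 * t) * h1 ‖x‖ + Real.exp (k2 * t) * h2 ‖x‖) ≤
      lap n (fun y => v y t) x := by
    refine lap_ge_of_min (hv.smooth_space t ht.1)
      (Rζ.add ((R1.mul (Real.exp (k1 * t))).add (R2.mul (Real.exp (k2 * t))))) hpos ?_
    filter_upwards [hnhd] with y hy
    have := hle y hy t ⟨ht.1.le, le_rfl⟩
    linarith
  have hd1 := sol_hasDeriv hv x ht.1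
  have hIoo : Ioo 0 t ∈ nhdsWithin t (Iio t) := Ioo_mem_nhdsLT ht.1
  rcases (hv.nonneg x t ht.1.le).lt_or_eq with hvp | hv0
  · have hb := barrier_time (ζ ‖x‖) (g1 ‖x‖) (g2 ‖x‖) k1 k2 t
    have hd2 := hb.rpow_const (p := p) (Or.inr hp.le)
    have hbp : ∀ᶠ s in nhds t,
        0 < ζ ‖x‖ + (Real.exp (k1 * s) * g1 ‖x‖ + Real.exp (k2 * s) * g2 ‖x‖) :=
      hb.continuousAt.eventually (lt_mem_nhds (by rw [heq'] at hvp; exact hvp))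
    rw [← heq'] at hd2
    have hd := hd2.sub hd1
    have := deriv_nonneg_of_left hd (by
      filter_upwards [hIoo, nhdsWithin_le_nhds hbp] with s hs hsp
      have hle1 := hle x hx s ⟨hs.1.le, hs.2.le⟩
      have : (ζ ‖x‖ + (Real.exp (k1 * s) * g1 ‖x‖ + Real.exp (k2 * s) * g2 ‖x‖)) ^ p ≤ v x s ^ p :=
        Real.rpow_le_rpow hsp.le (by linarith) (by linarith)
      simp only [Pi.sub_apply]
      rw [← heq']
      linarith)
    nlinarith
  · have z1 : v x t ^ (p - 1) = 0 := by rw [← hv0]; exact Real.zero_rpow (by linarith)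
    have z2 : v x t ^ p = 0 := by rw [← hv0]; exact Real.zero_rpow (by linarith)
    rw [z1, z2] at hineq'
    rw [z2] at hd1
    have := deriv_nonneg_of_left hd1.neg (by
      filter_upwards [hIoo] with s hs
      have : 0 ≤ v x s ^ p := Real.rpow_nonneg (hv.nonneg x s hs.1.le) _
      simp only [Pi.neg_apply]
      rw [z2]; linarith)
    linarith

lemma RadLap.of {n : ℕ} {g g1 g2 h : ℝ → ℝ} (a : ∀ r > 0, HasDerivAt g (g1 r) r)
    (b : ∀ r > 0, HasDerivAt g1 (g2 r) r)
    (c : ∀ r > 0, h r = g2 r + ((n : ℝ) - 1) / r * g1 r) : RadLap n g h := by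
  refine ⟨g1, a, fun r hr => ?_⟩
  rw [c r hr]
  refine (b r hr).congr_deriv ?_
  ring

lemma radLap_pow (n : ℕ) (s : ℝ) :
    RadLap n (fun r => r ^ (-s)) (fun r => -(s * ((n : ℝ) - 2 - s)) * (r ^ (-s) / r ^ 2)) := by
  refine RadLap.of (g1 := fun r => (-s) * r ^ (-s - 1))
    (g2 := fun r => (-s) * ((-s - 1) * r ^ (-s - 1 - 1))) ?_ ?_ ?_
  · intro r hr; exact Real.hasDerivAt_rpow_const (Or.inl hr.ne')
  · intro r hr; exact (Real.hasDerivAt_rpow_const (Or.inl hr.ne')).const_mul _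
  · intro r hr
    have hr0 : (r : ℝ) ≠ 0 := hr.ne'
    rw [Real.rpow_sub_one hr0 (-s - 1), Real.rpow_sub_one hr0 (-s)]
    field_simp
    ring

lemma radLap_const (n : ℕ) (c : ℝ) : RadLap n (fun _ => c) (fun _ => 0) := by
  refine RadLap.of (g1 := fun _ => 0) (g2 := fun _ => 0) ?_ ?_ ?_
  · intro r hr; exact hasDerivAt_const _ _
  · intro r hr; exact hasDerivAt_const _ _
  · intro r hr; simp

lemma radLap_sq (n : ℕ) : RadLap n (fun r => r ^ 2) (fun _ => 2 * (n : ℝ)) := by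
  refine RadLap.of (g1 := fun r => 2 * r) (g2 := fun _ => 2) ?_ ?_ ?_
  · intro r hr; simpa using hasDerivAt_pow 2 r
  · intro r hr; simpa using (hasDerivAt_id r).const_mul 2
  · intro r hr; field_simp; ring

lemma radLap_exp (n : ℕ) (k : ℝ) : RadLap n (fun r => Real.exp (-k * r))
    (fun r => (k ^ 2 - ((n : ℝ) - 1) / r * k) * Real.exp (-k * r)) := by
  have h : ∀ r : ℝ, HasDerivAt (fun r : ℝ => Real.exp (-k * r)) (Real.exp (-k * r) * (-k * 1)) r :=
    fun r => ((hasDerivAt_id r).const_mul (-k)).exp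
  refine RadLap.of (g1 := fun r => Real.exp (-k * r) * (-k * 1))
    (g2 := fun r => Real.exp (-k * r) * (-k * 1) * (-k * 1)) ?_ ?_ ?_
  · intro r hr; exact h r
  · intro r hr; exact (h r).mul_const _
  · intro r hr; ring

lemma radLap_bump (n : ℕ) (ρ : ℝ) : RadLap n
    (fun r => (1 / 4 - (r / ρ - 1) ^ 2) + 2 * n * (1 / 4 - (r / ρ - 1) ^ 2) ^ 2)
    (fun r => (-2 / ρ ^ 2) * (1 + 4 * n * (1 / 4 - (r / ρ - 1) ^ 2))
      + 4 * n * (-2 * (r / ρ - 1) / ρ) ^ 2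
      + ((n : ℝ) - 1) / r * (-2 * (r / ρ - 1) / ρ * (1 + 4 * n * (1 / 4 - (r / ρ - 1) ^ 2)))) := by
  have hy : ∀ r : ℝ, HasDerivAt (fun r : ℝ => 1 / 4 - (r / ρ - 1) ^ 2) (-2 * (r / ρ - 1) / ρ) r := by
    intro r
    refine ((((((hasDerivAt_id r).div_const ρ).sub_const 1).pow 2)).const_sub (1/4)).congr_deriv ?_
    simp; ring
  refine RadLap.of
    (g1 := fun r => -2 * (r / ρ - 1) / ρ * (1 + 4 * n * (1 / 4 - (r / ρ - 1) ^ 2)))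
    (g2 := fun r => (-2 / ρ ^ 2) * (1 + 4 * n * (1 / 4 - (r / ρ - 1) ^ 2))
      + 4 * n * (-2 * (r / ρ - 1) / ρ) ^ 2) ?_ ?_ ?_
  · intro r hr
    refine ((hy r).add (((hy r).pow 2).const_mul (2 * (n:ℝ)))).congr_deriv ?_
    simp; ring
  · intro r hr
    have h1 : HasDerivAt (fun r : ℝ => -2 * (r / ρ - 1) / ρ) (-2 / ρ ^ 2) r := by
      refine (((((hasDerivAt_id r).div_const ρ).sub_const 1).const_mul (-2)).div_const ρ).congr_deriv ?_
      field_simp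
    refine (h1.mul (((hy r).const_mul (4 * (n:ℝ))).const_add 1)).congr_deriv ?_
    ring
  · intro r hr; rfl

lemma convex_bound {p a b : ℝ} (hp : 1 ≤ p) (hb : 0 ≤ b) (hab : b ≤ a) :
    a ^ p - b ^ p ≤ p * a ^ (p - 1) * (a - b) := by
  rcases (hb.trans hab).lt_or_eq with ha | ha
  · have h := one_add_mul_self_le_rpow_one_add (s := b / a - 1)
      (by have : 0 ≤ b / a := by positivity
          linarith) hp
    have e : (1 + (b / a - 1)) = b / a := by ring
    rw [e, Real.div_rpow hb ha.le] at h
    have hap : 0 < a ^ p := Real.rpow_pos_of_pos ha p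
    have h2 : (1 + p * (b / a - 1)) * a ^ p ≤ b ^ p := by
      rwa [le_div_iff₀ hap] at h
    have e2 : a ^ (p - 1) = a ^ p / a := Real.rpow_sub_one ha.ne' p
    rw [e2]
    have : (1 + p * (b / a - 1)) * a ^ p = a ^ p - p * (a ^ p / a) * (a - b) := by
      field_simp; ring
    linarith
  · have : b = 0 := by linarith
    subst this; subst ha; simp

structure Setup (n : ℕ) (p ν L γ κ : ℝ) (φ : ℝ → ℝ) : Prop where
  hn : 10 < n
  hp : 1 < p
  hν : 0 < ν
  hνp : ν * (p - 1) = 2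
  hL : 0 < L
  hγ : ν < γ
  hγ2 : γ < ((n : ℝ) - 2) / 2
  hκ : 0 < κ
  hA : γ * ((n : ℝ) - 2 - γ) = (1 + κ) * (p * L ^ (p - 1))
  RΦ : RadLap n (fun r => L * r ^ (-ν)) (fun r => - (L * r ^ (-ν)) ^ p)
  Rφ : RadLap n φ (fun r => - (φ r) ^ p)
  φpos : ∀ r > 0, 0 < φ r
  φle : ∀ r > 0, φ r ≤ L * r ^ (-ν)
  φbd : ∃ α > 0, ∀ r > 0, φ r ≤ α
  anti : ∀ r > 0, ∀ s, r ≤ s → φ s ≤ φ r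
  ratio : ∀ θ < 1, ∃ s0 > 0, ∀ s ≥ s0, θ * (L * s ^ (-ν)) ≤ φ s
  gap : ∀ B : ℝ, ∃ R > 0, ∀ r ≥ R, φ r + B * r ^ (-γ) < L * r ^ (-ν)

lemma Phi_pow {p ν L r : ℝ} (hνp : ν * (p - 1) = 2) (hL : 0 < L) (hr : 0 < r) :
    (L * r ^ (-ν)) ^ (p - 1) = L ^ (p - 1) / r ^ 2 := by
  rw [Real.mul_rpow hL.le (Real.rpow_nonneg hr.le _), ← Real.rpow_mul hr.le]
  have : -ν * (p - 1) = -2 := by linarith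
  rw [this, Real.rpow_neg hr.le, Real.rpow_two]; rfl

lemma ratio_of {ν l L a : ℝ} {φ : ℝ → ℝ} (hL : 0 < L) (hlpos : 0 < l) (ha : 0 < a)
    (hexp : (fun r => φ r - (L * r ^ (-ν) - a * r ^ (-ν - l)))
      =o[atTop] fun r => r ^ (-ν - l)) :
    ∀ θ < 1, ∃ s0 > 0, ∀ s ≥ s0, θ * (L * s ^ (-ν)) ≤ φ s := by
  intro θ hθ
  have h1 := (hexp.def (c := 1) one_pos)
  have h2 : Tendsto (fun s : ℝ => s ^ (-l)) atTop (nhds 0) := tendsto_rpow_neg_atTop hlpos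
  have h3 : ∀ᶠ s : ℝ in atTop, s ^ (-l) < (1 - θ) * L / (a + 1) :=
    h2.eventually (gt_mem_nhds (by
      apply div_pos (mul_pos (by linarith) hL) (by linarith)))
  obtain ⟨s0, hs0⟩ := eventually_atTop.mp (h1.and (h3.and (eventually_gt_atTop 0)))
  refine ⟨max s0 1, by positivity, fun s hs => ?_⟩
  obtain ⟨e1, e2, e3⟩ := hs0 s (le_trans (le_max_left _ _) hs)
  rw [Real.norm_eq_abs, Real.norm_eq_abs, one_mul,
    abs_of_pos (Real.rpow_pos_of_pos e3 _)] at e1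
  have e4 := (abs_le.mp e1).1
  have e5 : s ^ (-ν - l) = s ^ (-ν) * s ^ (-l) := by
    rw [← Real.rpow_add e3]; ring_nf
  rw [lt_div_iff₀ (by linarith)] at e2
  have hsν : 0 < s ^ (-ν) := Real.rpow_pos_of_pos e3 _
  rw [e5] at e4
  have := mul_lt_mul_of_pos_left e2 hsν
  nlinarith

lemma gap_of {ν l L a γ : ℝ} {φ : ℝ → ℝ} (hγ : ν + l < γ) (ha : 0 < a)
    (hexp : (fun r => φ r - (L * r ^ (-ν) - a * r ^ (-ν - l)))
      =o[atTop] fun r => r ^ (-ν - l)) :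
    ∀ B : ℝ, ∃ R > 0, ∀ r ≥ R, φ r + B * r ^ (-γ) < L * r ^ (-ν) := by
  intro B
  have h1 := (hexp.def (c := a / 2) (by linarith))
  have h2 : Tendsto (fun s : ℝ => |B| * s ^ (-(γ - ν - l))) atTop (nhds (|B| * 0)) :=
    (tendsto_rpow_neg_atTop (by linarith)).const_mul _
  have h3 : ∀ᶠ s : ℝ in atTop, |B| * s ^ (-(γ - ν - l)) < a / 2 :=
    h2.eventually (gt_mem_nhds (by simp; linarith))
  obtain ⟨s0, hs0⟩ := eventually_atTop.mp (h1.and (h3.and (eventually_gt_atTop 0)))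
  refine ⟨max s0 1, by positivity, fun s hs => ?_⟩
  obtain ⟨e1, e2, e3⟩ := hs0 s (le_trans (le_max_left _ _) hs)
  rw [Real.norm_eq_abs, Real.norm_eq_abs, abs_of_pos (Real.rpow_pos_of_pos e3 _)] at e1
  have e4 := (abs_le.mp e1).2
  have e5 : s ^ (-γ) = s ^ (-ν - l) * s ^ (-(γ - ν - l)) := by
    rw [← Real.rpow_add e3]; ring_nf
  have hsν : 0 < s ^ (-ν - l) := Real.rpow_pos_of_pos e3 _
  have hs' : 0 < s ^ (-(γ - ν - l)) := Real.rpow_pos_of_pos e3 _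
  rw [e5]
  have k1 := mul_lt_mul_of_pos_left e2 hsν
  have k2 : B * (s ^ (-ν - l) * s ^ (-(γ - ν - l))) ≤
      |B| * (s ^ (-ν - l) * s ^ (-(γ - ν - l))) :=
    mul_le_mul_of_nonneg_right (le_abs_self B) (by positivity)
  nlinarith

lemma RPhi_of {n : ℕ} {p ν L : ℝ} (hνp : ν * (p - 1) = 2) (hL : 0 < L)
    (hLp : L ^ (p - 1) = ν * ((n:ℝ) - 2 - ν)) :
    RadLap n (fun r => L * r ^ (-ν)) (fun r => - (L * r ^ (-ν)) ^ p) := by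
  obtain ⟨g1, b1, b2⟩ := (radLap_pow n ν).mul L
  refine ⟨g1, b1, fun r hr => (b2 r hr).congr_deriv ?_⟩
  have hb : 0 < L * r ^ (-ν) := mul_pos hL (Real.rpow_pos_of_pos hr _)
  have e : (L * r ^ (-ν)) ^ p = (L * r ^ (-ν)) ^ (p - 1) * (L * r ^ (-ν)) := by
    rw [← Real.rpow_add_one hb.ne']; ring_nf
  simp only []
  rw [e, Phi_pow hνp hL hr, hLp]
  ring

lemma Rphi_of {n : ℕ} {p α a : ℝ} {φ : ℝ → ℝ} (hφ : IsSteadyStateA n p α φ a) :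
    RadLap n φ (fun r => - (φ r) ^ p) := by
  have hd1 : ∀ r > 0, HasDerivAt φ (deriv φ r) r := fun r hr =>
    ((hφ.smooth.differentiableOn (by norm_num) r hr).differentiableAt
      (Ioi_mem_nhds hr)).hasDerivAt
  have hd2 : ∀ r > 0, HasDerivAt (deriv φ) (deriv (deriv φ) r) r := by
    intro r hr
    have := hφ.smooth.deriv_of_isOpen (m := 1) isOpen_Ioi (by norm_num)
    exact ((this.differentiableOn (by norm_num) r hr).differentiableAt
      (Ioi_mem_nhds hr)).hasDerivAt
  refine RadLap.of hd1 hd2 fun r hr => ?_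
  have := hφ.ode r hr
  linarith

set_option maxHeartbeats 1000000 in
lemma setup_of (n : ℕ) (hn : 10 < n) (p α γ : ℝ)
    (hp : pc n < p) (hα : 0 < α)
    (hγ : γ ∈ Set.Ioo (nuExp p + lam1 n p) (((n : ℝ) - 2) / 2))
    (φ : ℝ → ℝ) (a : ℝ) (hφ : IsSteadyStateA n p α φ a) :
    Setup n p (nuExp p) (Lconst n p) γ (kappaOf n p γ) φ := by
  have hn' : (10:ℝ) < n := by exact_mod_cast hn
  have hn1 : (1:ℝ) < n - 2 := by linarith
  -- p lower bound
  have hp1 : ((n:ℝ) + 2) / (n - 2) < p := by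
    refine lt_of_le_of_lt ?_ hp
    unfold pc
    rw [div_le_div_iff₀ (by linarith) (by apply mul_pos <;> linarith)]
    have hs := Real.sqrt_nonneg ((n:ℝ) - 1)
    have : ((n:ℝ) + 2) * (n - 10) ≤ ((n:ℝ) - 2) ^ 2 - 4 * n + 8 * Real.sqrt ((n:ℝ) - 1) := by
      nlinarith
    nlinarith
  have hp4 : 4 / ((n:ℝ) - 2) < p - 1 := by
    have : ((n:ℝ) + 2) / (n - 2) = 1 + 4 / (n - 2) := by
      field_simp; ring
    linarith
  have hp0 : 0 < p - 1 := lt_trans (by positivity) hp4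
  have hp' : 1 < p := by linarith
  set ν := nuExp p with hν
  have hνpos : 0 < ν := by rw [hν]; unfold nuExp; positivity
  have hνp : ν * (p - 1) = 2 := by rw [hν]; unfold nuExp; field_simp
  have hν2 : 2 * ν < (n:ℝ) - 2 := by
    rw [div_lt_iff₀ (by linarith)] at hp4
    nlinarith
  have hLpos : 0 < ν * ((n:ℝ) - 2 - ν) := mul_pos hνpos (by linarith)
  have hL : 0 < Lconst n p := by
    unfold Lconst; exact Real.rpow_pos_of_pos hLpos _
  have hLp : Lconst n p ^ (p - 1) = ν * ((n:ℝ) - 2 - ν) := by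
    unfold Lconst
    rw [← Real.rpow_mul hLpos.le, one_div_mul_cancel hp0.ne', Real.rpow_one]
  have hpL : p * Lconst n p ^ (p - 1) = (ν + 2) * ((n:ℝ) - 2 - ν) := by
    rw [hLp]
    have : p * ν = ν + 2 := by linarith
    linear_combination ((n:ℝ) - 2 - ν) * this
  have hpLpos : 0 < p * Lconst n p ^ (p - 1) := by
    rw [hpL]; exact mul_pos (by linarith) (by linarith)
  set l := lam1 n p with hl
  set D := ((n : ℝ) - 2 - 2 * ν) ^ 2 - 8 * ((n : ℝ) - 2 - ν) with hD
  have hldef : l = (((n : ℝ) - 2 - 2 * ν) - Real.sqrt D) / 2 := rfl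
  have hγ1 := hγ.1
  have hγ2 := hγ.2
  have hsD : 0 < Real.sqrt D := by linarith
  have hDpos : 0 < D := Real.sqrt_pos.mp hsD
  have hsq : Real.sqrt D ^ 2 = D := Real.sq_sqrt hDpos.le
  have hlpos : 0 < l := by
    have : Real.sqrt D < (n:ℝ) - 2 - 2 * ν := by
      apply lt_of_pow_lt_pow_left₀ 2 (by linarith)
      rw [hsq]; linarith
    linarith
  have hroot : (ν + l) * ((n:ℝ) - 2 - (ν + l)) = p * Lconst n p ^ (p - 1) := by
    rw [hpL, hldef]
    nlinarith
  have hAgt : p * Lconst n p ^ (p - 1) < γ * ((n:ℝ) - 2 - γ) := by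
    rw [← hroot]
    nlinarith
  have hκ : 0 < kappaOf n p γ := by
    unfold kappaOf
    rw [sub_pos, lt_div_iff₀ hpLpos]; linarith
  have hpos := hφ.pos
  -- asymptotics
  have hexp := hφ.expansion
  have ha := hφ.a_pos
  refine ⟨hn, hp', hνpos, hνp, hL, by linarith, hγ2, hκ, ?_, RPhi_of hνp hL hLp, Rphi_of hφ,
    fun r hr => hpos r hr.le, hφ.upper, ⟨α, hα, fun r hr => ?_⟩, fun r hr s hs => ?_,
    ratio_of hL hlpos ha hexp, gap_of hγ1 ha hexp⟩
  · have e : 1 + kappaOf n p γ = γ * ((n : ℝ) - 2 - γ) / (p * Lconst n p ^ (p - 1)) := by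
      unfold kappaOf; ring
    rw [e, div_mul_cancel₀ _ hpLpos.ne']
  · rw [← hφ.val0]
    exact hφ.anti.antitoneOn (by simp) (by simpa using hr.le) hr.le
  · exact hφ.anti.antitoneOn (by simpa using hr.le) (by simpa using hr.le.trans hs) hs

lemma scaled_steady {n : ℕ} {p ν μ : ℝ} {φ : ℝ → ℝ} (hνp : ν * (p - 1) = 2) (hμ : 0 < μ)
    (φpos : ∀ r > 0, 0 < φ r)
    (h : RadLap n φ (fun r => - (φ r) ^ p)) :
    RadLap n (fun r => μ ^ ν * φ (μ * r)) (fun r => - (μ ^ ν * φ (μ * r)) ^ p) := by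
  obtain ⟨g1, a, b⟩ := h
  have hm : ∀ r : ℝ, HasDerivAt (fun r : ℝ => μ * r) (μ * 1) r :=
    fun r => (hasDerivAt_id r).const_mul μ
  refine ⟨fun r => μ ^ ν * (g1 (μ * r) * (μ * 1)), fun r hr => ?_, fun r hr => ?_⟩
  · exact ((a _ (mul_pos hμ hr)).comp r (hm r)).const_mul _
  · have := (((b _ (mul_pos hμ hr)).comp r (hm r)).mul_const (μ * 1)).const_mul (μ ^ ν)
    refine this.congr_deriv ?_
    simp only []
    rw [Real.mul_rpow (Real.rpow_nonneg hμ.le _) (φpos _ (mul_pos hμ hr)).le, ← Real.rpow_mul hμ.le]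
    have : ν * p = ν + 2 := by linarith
    rw [this, Real.rpow_add hμ, Real.rpow_two]
    field_simp


lemma time_shift {n : ℕ} {p : ℝ} {v : EE n → ℝ → ℝ} {v₀ : EE n → ℝ}
    (hv : IsBddClassicalSol n p v v₀) {t0 : ℝ} (ht0 : 0 ≤ t0) :
    IsBddClassicalSol n p (fun x t => v x (t0 + t)) (fun x => v x t0) := by
  refine ⟨fun x t ht => hv.nonneg x _ (by linarith), ?_, ?_, ?_, ?_, ?_, fun x => by simp⟩
  · exact hv.cont.comp (f := fun q : EE n × ℝ => (q.1, t0 + q.2)) (by fun_prop)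
      (fun q hq => ⟨mem_univ _, by have := hq.2; simp only [mem_Ici] at this ⊢; linarith⟩)
  · intro T hT
    obtain ⟨M, hM⟩ := hv.bdd (t0 + T) (by linarith)
    exact ⟨M, fun x t ht => hM x _ ⟨by linarith [ht.1], by linarith [ht.2]⟩⟩
  · intro t ht; exact hv.smooth_space (t0 + t) (by linarith)
  · intro x
    exact (hv.smooth_time x).comp (f := fun s : ℝ => t0 + s) (by fun_prop)
      (fun s hs => by simp only [mem_Ioi] at hs ⊢; linarith)
  · intro x t ht
    have := hv.pde x (t0 + t) (by linarith)
    rw [← this]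
    exact deriv_comp_const_add (fun s => v x s ^ p) t0 t

/-- lower bound for `φ^{p-1}(1+r²)`. -/
lemma phi_c0 {n : ℕ} {p ν L γ κ : ℝ} {φ : ℝ → ℝ} (S : Setup n p ν L γ κ φ) :
    ∃ c0 > 0, ∀ r > 0, c0 ≤ φ r ^ (p - 1) * (1 + r ^ 2) := by
  obtain ⟨s0, hs0, h⟩ := S.ratio (1/2) (by norm_num)
  have hL := S.hL
  have hp := S.hp
  have hφs := S.φpos s0 hs0
  refine ⟨min (φ s0 ^ (p - 1)) ((1/2) ^ (p - 1) * L ^ (p - 1)), by positivity, fun r hr => ?_⟩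
  have hφ := S.φpos r hr
  rcases le_total r s0 with h1 | h1
  · refine (min_le_left _ _).trans ?_
    have h2 : φ s0 ^ (p - 1) ≤ φ r ^ (p - 1) :=
      Real.rpow_le_rpow hφs.le (S.anti r hr s0 h1) (by linarith)
    have h3 : 0 ≤ φ r ^ (p - 1) := by positivity
    nlinarith [sq_nonneg r]
  · refine (min_le_right _ _).trans ?_
    have h2 : (1/2 * (L * r ^ (-ν))) ^ (p - 1) ≤ φ r ^ (p - 1) :=
      Real.rpow_le_rpow (by positivity) (h r h1) (by linarith)
    rw [Real.mul_rpow (by norm_num) (by positivity), Phi_pow S.hνp hL hr] at h2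
    have h3 : (1/2 : ℝ) ^ (p - 1) * (L ^ (p - 1) / r ^ 2) * r ^ 2 = (1/2 : ℝ) ^ (p - 1) * L ^ (p - 1) := by
      field_simp
    have h4 := mul_le_mul_of_nonneg_right h2 (sq_nonneg r)
    have h5 : 0 ≤ φ r ^ (p - 1) := by positivity
    linarith

lemma ptail_small {s M : ℝ} (hs : 0 < s) {B : ℝ} (hB : 0 < B) : ∃ c > 0, c < 1 ∧ ∀ r > 0, r < c → M < B * r ^ (-s) := by
  have h : Tendsto (fun r : ℝ => r ^ (-s)) (nhdsWithin 0 (Ioi 0)) atTop :=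
    tendsto_rpow_neg_nhdsGT_zero (by linarith)
  have h2 := (h.const_mul_atTop hB).eventually_gt_atTop M
  obtain ⟨c, hc, h3⟩ := (mem_nhdsGT_iff_exists_Ioo_subset).1 h2
  refine ⟨min c (1/2), lt_min hc (by norm_num), (min_le_right _ _).trans_lt (by norm_num), fun r hr hrc => ?_⟩
  exact h3 ⟨hr, hrc.trans_le (min_le_left _ _)⟩

lemma ptail_large {s B ε : ℝ} (hs : 0 < s) (hε : 0 < ε) : ∃ R > 1, ∀ r ≥ R, B * r ^ (-s) < ε := by
  have h : Tendsto (fun r : ℝ => B * r ^ (-s)) atTop (nhds (B * 0)) :=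
    (tendsto_rpow_neg_atTop hs).const_mul B
  rw [mul_zero] at h
  obtain ⟨R, hR⟩ := eventually_atTop.1 (h.eventually (gt_mem_nhds hε))
  refine ⟨max R 2, lt_max_of_lt_right (by norm_num), fun r hr => hR r ((le_max_left _ _).trans hr)⟩

lemma rpow_ne_one_le {r s : ℝ} (hr : 0 < r) (hr1 : r ≤ 1) (hs : 0 ≤ s) : 1 ≤ r ^ (-s) := by
  exact Real.one_le_rpow_of_pos_of_le_one_of_nonpos hr hr1 (by linarith)

lemma rpow_split {p a : ℝ} (ha : 0 ≤ a) (hp : 1 < p) : a ^ p = a ^ (p - 1) * a := by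
  rcases ha.lt_or_eq with h | h
  · rw [← Real.rpow_add_one h.ne']; ring_nf
  · subst h; rw [Real.zero_rpow (by linarith)]; simp

/-- S1 -/
lemma step1 {n : ℕ} {p ν L γ κ : ℝ} {φ : ℝ → ℝ} (S : Setup n p ν L γ κ φ)
    {v : EE n → ℝ → ℝ} {v₀ : EE n → ℝ} (hv : IsBddClassicalSol n p v v₀)
    (h0 : ∀ x : EE n, x ≠ 0 → v₀ x ≤ L * ‖x‖ ^ (-ν)) :
    ∀ x : EE n, x ≠ 0 → ∀ t ≥ 0, v x t ≤ L * ‖x‖ ^ (-ν) := by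
  intro x hx t ht
  obtain ⟨M, hM⟩ := hv.bdd (t + 1) (by linarith)
  have hL := S.hL
  have hp := S.hp
  have hLp : 0 < L ^ (p - 1) := by positivity
  have hn : (10 : ℝ) < n := by exact_mod_cast S.hn
  set K : ℝ := 1 + (2 * n) / (p * L ^ (p - 1)) with hK
  have hKL : (K - 1) * (p * L ^ (p - 1)) = 2 * n := by
    rw [hK]; field_simp; ring
  have hK1 : 1 < K := by
    have : 0 < (2 * n) / (p * L ^ (p - 1)) := by positivity
    linarith
  have key : ∀ ε > 0, v x t ≤ L * ‖x‖ ^ (-ν) + ε * (Real.exp (K * t) * (1 + ‖x‖ ^ 2)) := by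
    intro ε hε
    obtain ⟨c, hc, hc1, hcM⟩ := ptail_small (M := M) S.hν hL
    set d : ℝ := max 1 (M / ε) with hd
    have := cmp_upper hp hv (T := t) isOpen_Ioi (subset_refl (Ioi (0:ℝ))) c d
      (fun r hr => lt_of_lt_of_le hc hr.1) S.RΦ (radLap_const n 0)
      (((radLap_const n 1).add (radLap_sq n)).mul ε) 0 K ?_ ?_ ?_ x (by simpa using hx) t
      ⟨ht, le_refl _⟩
    · simp only [mul_zero, zero_add] at this
      linarith
    · intro y hy
      have hy0 : y ≠ 0 := by simpa using hy
      have := h0 y hy0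
      have : 0 < ε * (1 + ‖y‖ ^ 2) := by positivity
      linarith [h0 y hy0]
    · intro y hy hyK s hs
      have hy' : 0 < ‖y‖ := hy
      have hvM := hM y s ⟨hs.1, by linarith [hs.2]⟩
      have hΦ : 0 < L * ‖y‖ ^ (-ν) := by positivity
      have he : 1 ≤ Real.exp (K * s) := Real.one_le_exp (mul_nonneg (by linarith) hs.1)
      have hz : 0 < ε * (1 + ‖y‖ ^ 2) := by positivity
      have hz1 : ε * (1 + ‖y‖ ^ 2) ≤ Real.exp (K * s) * (ε * (1 + ‖y‖ ^ 2)) := by nlinarith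
      simp only [mul_zero, zero_add]
      rcases lt_or_ge ‖y‖ c with h | h
      · have := hcM _ hy' h
        linarith
      · have hd' : d < ‖y‖ := by
          by_contra hh
          exact hyK ⟨h, not_lt.1 hh⟩
        have h1 : 1 < ‖y‖ := (le_max_left _ _).trans_lt hd'
        have h2 : M / ε < ‖y‖ := (le_max_right _ _).trans_lt hd'
        rw [div_lt_iff₀ hε] at h2
        have : ‖y‖ * ε ≤ ε * (1 + ‖y‖ ^ 2) := by nlinarith
        linarith
    · intro y hy s hs hveq
      have hy' : 0 < ‖y‖ := hy
      simp only [mul_zero, zero_add] at hveq ⊢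
      have hΦ : 0 < L * ‖y‖ ^ (-ν) := by positivity
      set Φ := L * ‖y‖ ^ (-ν) with hΦd
      set E := Real.exp (K * s) with hE
      have hEpos : 0 < E := Real.exp_pos _
      set z := E * (ε * (1 + ‖y‖ ^ 2)) with hz
      have hzpos : 0 < z := by positivity
      have hcv := convex_bound (p := p) hp.le hΦ.le (a := v y s) (by rw [hveq]; linarith)
      have hvz : v y s - Φ = z := by rw [hveq]; ring
      rw [hvz] at hcv
      have hvp : L ^ (p - 1) / ‖y‖ ^ 2 ≤ v y s ^ (p - 1) := by
        rw [← Phi_pow S.hνp hL hy']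
        exact Real.rpow_le_rpow hΦ.le (by rw [hveq]; linarith) (by linarith)
      rw [div_le_iff₀ (by positivity)] at hvp
      have hvpos : 0 < v y s ^ (p - 1) := by
        have : 0 < v y s := by rw [hveq]; linarith
        positivity
      have h5 : E * (ε * (2 * n)) < (K - 1) * (p * v y s ^ (p - 1)) * z := by
        have : E * (ε * (2 * n)) = ((K - 1) * p * (E * ε)) * L ^ (p - 1) := by
          rw [← hKL]; ring
        rw [this]
        have e2 : (K - 1) * (p * v y s ^ (p - 1)) * z =
          ((K - 1) * p * (E * ε)) * (v y s ^ (p - 1) * (1 + ‖y‖ ^ 2)) := by rw [hz]; ring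
        rw [e2]
        apply mul_lt_mul_of_pos_left
        · linarith
        · have : 0 < K - 1 := by linarith
          positivity
      nlinarith
  have hc : 0 < Real.exp (K * t) * (1 + ‖x‖ ^ 2) := by positivity
  refine le_of_forall_pos_le_add fun δ hδ => ?_
  have := key (δ / (Real.exp (K * t) * (1 + ‖x‖ ^ 2))) (by positivity)
  rwa [div_mul_cancel₀ _ hc.ne'] at this


/-- S2 -/
lemma step2 {n : ℕ} {p ν L γ κ : ℝ} {φ : ℝ → ℝ} (S : Setup n p ν L γ κ φ)
    {v : EE n → ℝ → ℝ} {v₀ : EE n → ℝ} (hv : IsBddClassicalSol n p v v₀)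
    (hΦv : ∀ x : EE n, x ≠ 0 → ∀ t ≥ 0, v x t ≤ L * ‖x‖ ^ (-ν)) {B : ℝ} (hB : 0 < B)
    (h0 : ∀ x : EE n, x ≠ 0 → v₀ x ≤ φ ‖x‖ + B * ‖x‖ ^ (-γ)) :
    ∀ x : EE n, x ≠ 0 → ∀ t ≥ 0, v x t ≤ φ ‖x‖ + Real.exp (-κ * t) * (B * ‖x‖ ^ (-γ)) := by
  intro x hx t ht
  obtain ⟨M, hM⟩ := hv.bdd (t + 1) (by linarith)
  have hL := S.hL
  have hp := S.hp
  have hγ0 : 0 < γ := S.hν.trans S.hγ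
  have hLp : 0 < L ^ (p - 1) := by positivity
  have hn : (10 : ℝ) < n := by exact_mod_cast S.hn
  obtain ⟨c0, hc0, hc0'⟩ := phi_c0 S
  set K : ℝ := 1 + (2 * n + 1) / (p * c0) with hK
  have hKL : (K - 1) * (p * c0) = 2 * n + 1 := by
    rw [hK]; field_simp; ring
  have hK1 : 1 < K := by
    have : 0 < (2 * n + 1) / (p * c0) := by positivity
    linarith
  have key : ∀ ε > 0, v x t ≤ φ ‖x‖ + Real.exp (-κ * t) * (B * ‖x‖ ^ (-γ))
      + ε * (Real.exp (K * t) * (1 + ‖x‖ ^ 2)) := by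
    intro ε hε
    obtain ⟨c, hc, hc1, hcM⟩ := ptail_small (M := M) hγ0
      (show 0 < Real.exp (-κ * t) * B by positivity)
    set d : ℝ := max 1 (M / ε) with hd
    have := cmp_upper hp hv (T := t) isOpen_Ioi (subset_refl (Ioi (0:ℝ))) c d
      (fun r hr => lt_of_lt_of_le hc hr.1) S.Rφ ((radLap_pow n γ).mul B)
      (((radLap_const n 1).add (radLap_sq n)).mul ε) (-κ) K ?_ ?_ ?_ x (by simpa using hx) t
      ⟨ht, le_refl _⟩
    · linarith
    · intro y hy
      have hy0 : y ≠ 0 := by simpa using hy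
      have := h0 y hy0
      have : 0 < ε * (1 + ‖y‖ ^ 2) := by positivity
      linarith [h0 y hy0]
    · intro y hy hyK s hs
      have hy' : 0 < ‖y‖ := hy
      have hvM := hM y s ⟨hs.1, by linarith [hs.2]⟩
      have hφ := S.φpos _ hy'
      have he : 1 ≤ Real.exp (K * s) := Real.one_le_exp (mul_nonneg (by linarith) hs.1)
      have hz : 0 < ε * (1 + ‖y‖ ^ 2) := by positivity
      have hz1 : ε * (1 + ‖y‖ ^ 2) ≤ Real.exp (K * s) * (ε * (1 + ‖y‖ ^ 2)) := by nlinarith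
      have hz2 : 0 < Real.exp (-κ * s) * (B * ‖y‖ ^ (-γ)) := by positivity
      have hz3 : Real.exp (-κ * t) * B * ‖y‖ ^ (-γ) ≤ Real.exp (-κ * s) * (B * ‖y‖ ^ (-γ)) := by
        rw [mul_assoc]
        apply mul_le_mul_of_nonneg_right _ (by positivity)
        apply Real.exp_le_exp.2
        have := S.hκ
        nlinarith [hs.2]
      rcases lt_or_ge ‖y‖ c with h | h
      · have := hcM _ hy' h
        linarith
      · have hd' : d < ‖y‖ := by
          by_contra hh
          exact hyK ⟨h, not_lt.1 hh⟩
        have h1 : 1 < ‖y‖ := (le_max_left _ _).trans_lt hd'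
        have h2 : M / ε < ‖y‖ := (le_max_right _ _).trans_lt hd'
        rw [div_lt_iff₀ hε] at h2
        have : ‖y‖ * ε ≤ ε * (1 + ‖y‖ ^ 2) := by nlinarith
        linarith
    · intro y hy s hs hveq
      have hy' : 0 < ‖y‖ := hy
      have hy0 : y ≠ 0 := by simpa using hy
      have hφ := S.φpos _ hy'
      set E := Real.exp (K * s) with hE
      have hEpos : 0 < E := Real.exp_pos _
      set z := E * (ε * (1 + ‖y‖ ^ 2)) with hz
      have hzpos : 0 < z := by positivity
      set z1 := Real.exp (-κ * s) * (B * ‖y‖ ^ (-γ)) with hz1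
      have hz1pos : 0 < z1 := by positivity
      have hvz : v y s - φ ‖y‖ = z1 + z := by rw [hveq]; ring
      have hcv := convex_bound (p := p) hp.le hφ.le (a := v y s) (by linarith)
      rw [hvz] at hcv
      have hvp : φ ‖y‖ ^ (p - 1) ≤ v y s ^ (p - 1) :=
        Real.rpow_le_rpow hφ.le (by linarith) (by linarith)
      have hvp2 : v y s ^ (p - 1) ≤ L ^ (p - 1) / ‖y‖ ^ 2 := by
        rw [← Phi_pow S.hνp hL hy']
        exact Real.rpow_le_rpow (by linarith) (hΦv y hy0 s hs.1.le) (by linarith)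
      have hc1 := hc0' _ hy'
      have hc2 : c0 ≤ v y s ^ (p - 1) * (1 + ‖y‖ ^ 2) :=
        hc1.trans (mul_le_mul_of_nonneg_right hvp (by positivity))
      have h5 : E * (ε * (0 + 2 * n)) < (K - 1) * (p * v y s ^ (p - 1)) * z := by
        have e2 : (K - 1) * (p * v y s ^ (p - 1)) * z =
          ((K - 1) * p * (v y s ^ (p - 1) * (1 + ‖y‖ ^ 2))) * (E * ε) := by rw [hz]; ring
        rw [e2]
        have e3 : (K - 1) * p * c0 ≤ (K - 1) * p * (v y s ^ (p - 1) * (1 + ‖y‖ ^ 2)) := by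
          apply mul_le_mul_of_nonneg_left hc2
          have : 0 < K - 1 := by linarith
          positivity
        have e4 : 2 * (n:ℝ) < (K - 1) * p * (v y s ^ (p - 1) * (1 + ‖y‖ ^ 2)) := by linarith
        have := mul_lt_mul_of_pos_right e4 (mul_pos hEpos hε)
        linarith
      have h6 : (1 + κ) * (p * v y s ^ (p - 1)) * z1 ≤
          γ * ((n : ℝ) - 2 - γ) / ‖y‖ ^ 2 * z1 := by
        apply mul_le_mul_of_nonneg_right _ hz1pos.le
        rw [S.hA]
        have : (1 + κ) * (p * L ^ (p - 1)) / ‖y‖ ^ 2 = (1 + κ) * p * (L ^ (p - 1) / ‖y‖ ^ 2) := by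
          ring
        rw [this]
        have hκ := S.hκ
        have := mul_le_mul_of_nonneg_left hvp2 (show 0 ≤ (1 + κ) * p by positivity)
        linarith
      have h7 : Real.exp (-κ * s) * (B * (-(γ * ((n : ℝ) - 2 - γ)) * (‖y‖ ^ (-γ) / ‖y‖ ^ 2))) =
          - (γ * ((n : ℝ) - 2 - γ) / ‖y‖ ^ 2 * z1) := by rw [hz1]; ring
      rw [h7]
      linarith
  have hc : 0 < Real.exp (K * t) * (1 + ‖x‖ ^ 2) := by positivity
  refine le_of_forall_pos_le_add fun δ hδ => ?_
  have := key (δ / (Real.exp (K * t) * (1 + ‖x‖ ^ 2))) (by positivity)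
  rwa [div_mul_cancel₀ _ hc.ne'] at this

/-- S4, upper bound in a ball -/
lemma step4 {n : ℕ} {p ν L γ κ : ℝ} {φ : ℝ → ℝ} (S : Setup n p ν L γ κ φ)
    {v : EE n → ℝ → ℝ} {v₀ : EE n → ℝ} (hv : IsBddClassicalSol n p v v₀)
    (hΦv : ∀ x : EE n, x ≠ 0 → ∀ t ≥ 0, v x t ≤ L * ‖x‖ ^ (-ν)) {B : ℝ} (hB : 0 < B)
    (h2 : ∀ x : EE n, x ≠ 0 → ∀ t ≥ 0, v x t ≤ φ ‖x‖ + Real.exp (-κ * t) * (B * ‖x‖ ^ (-γ)))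
    {M : ℝ} (hM : 0 < M) (hvM : ∀ x : EE n, x ≠ 0 → ∀ t ≥ 0, v x t ≤ M) :
    ∃ C > 0, ∀ x : EE n, x ≠ 0 → ∀ t ≥ 0, v x t ≤ φ ‖x‖ + C * Real.exp (-κ * t) := by
  have hL := S.hL
  have hp := S.hp
  have hκ := S.hκ
  have hγ0 : 0 < γ := S.hν.trans S.hγ
  have hn : (10 : ℝ) < n := by exact_mod_cast S.hn
  set q : ℝ := (1 + κ) * (p * M ^ (p - 1)) with hq
  have hqpos : 0 < q := by positivity
  obtain ⟨ρ, hρ, hρq⟩ : ∃ ρ > 0, q * (2 * ρ) ^ 2 ≤ 1 / 2 := by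
    refine ⟨min 1 (1 / (8 * q)), by positivity, ?_⟩
    set ρ := min 1 (1 / (8 * q))
    have a1 : 0 < ρ := by positivity
    have a2 : ρ ≤ 1 := min_le_left _ _
    have a3 : ρ ≤ 1 / (8 * q) := min_le_right _ _
    rw [le_div_iff₀ (by positivity)] at a3
    nlinarith
  set C : ℝ := 2 * (B * ρ ^ (-γ) + M) with hC
  have hCpos : 0 < C := by positivity
  refine ⟨C, hCpos, fun x hx t ht => ?_⟩
  have hx' : 0 < ‖x‖ := by simpa using hx
  have hbig : ∀ y : EE n, ρ ≤ ‖y‖ → B * ‖y‖ ^ (-γ) < C / 2 := by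
    intro y hy
    have := Real.rpow_le_rpow_of_nonpos hρ hy (show -γ ≤ 0 by linarith)
    rw [hC]; nlinarith
  rcases le_or_gt ρ ‖x‖ with hxr | hxr
  · have a1 := h2 x hx t ht
    have a2 := hbig x hxr
    have a3 := mul_le_mul_of_nonneg_left (show B * ‖x‖ ^ (-γ) ≤ C by linarith)
      (Real.exp_pos (-κ * t)).le
    linarith
  have key : ∀ ε > 0, v x t ≤ φ ‖x‖ + C * Real.exp (-κ * t)
      + ε * (Real.exp (-κ * t) * ‖x‖ ^ (-γ)) := by
    intro ε hε
    obtain ⟨c, hc, hc1, hcM⟩ := ptail_small (M := M) hγ0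
      (show 0 < Real.exp (-κ * t) * ε by positivity)
    have R1 := (((radLap_const n 1).add ((radLap_sq n).mul (-q))).mul C)
    have hg : ∀ y : EE n, ‖y‖ ∈ Ioo 0 (2 * ρ) → C / 2 ≤ C * (1 + -q * ‖y‖ ^ 2) := by
      intro y hy
      have : ‖y‖ ^ 2 ≤ (2 * ρ) ^ 2 := pow_le_pow_left₀ hy.1.le hy.2.le 2
      have h3 : q * ‖y‖ ^ 2 ≤ 1 / 2 := (mul_le_mul_of_nonneg_left this hqpos.le).trans hρq
      have h4 := mul_le_mul_of_nonneg_left h3 hCpos.le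
      linarith
    have := cmp_upper hp hv (T := t) isOpen_Ioo
      (fun r hr => hr.1 : Ioo (0:ℝ) (2 * ρ) ⊆ Ioi 0) c ρ
      (fun r hr => ⟨lt_of_lt_of_le hc hr.1, by linarith [hr.2]⟩) S.Rφ R1
      ((radLap_pow n γ).mul ε) (-κ) (-κ) ?_ ?_ ?_ x ⟨hx', by linarith⟩ t
      ⟨ht, le_refl _⟩
    · have e1 : C * (1 + -q * ‖x‖ ^ 2) ≤ C := by
        have := mul_nonneg (mul_pos hCpos hqpos).le (sq_nonneg ‖x‖)
        linarith
      have e2 := mul_le_mul_of_nonneg_left e1 (Real.exp_pos (-κ * t)).le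
      linarith
    · intro y hy
      have hy0 : y ≠ 0 := by simpa using hy.1.ne'
      have hy1 := hy.1
      have := hg y hy
      have a1 := hvM y hy0 0 le_rfl
      rw [hv.init] at a1
      have a2 : M < C / 2 := by
        have : 0 < B * ρ ^ (-γ) := by positivity
        rw [hC]; linarith
      have a3 : 0 < ε * ‖y‖ ^ (-γ) := by positivity
      have a4 := S.φpos _ hy.1
      linarith
    · intro y hy hyK s hs
      have hy' : 0 < ‖y‖ := hy.1
      have hy0 : y ≠ 0 := by simpa using hy.1.ne'
      have hφ := S.φpos _ hy'
      have hvM1 := hvM y hy0 s hs.1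
      have hg1 := hg y hy
      have a3 : 0 < Real.exp (-κ * s) * (ε * ‖y‖ ^ (-γ)) := by positivity
      have a4 : Real.exp (-κ * s) * (C / 2) ≤ Real.exp (-κ * s) * (C * (1 + -q * ‖y‖ ^ 2)) :=
        mul_le_mul_of_nonneg_left hg1 (Real.exp_pos _).le
      have a5 : 0 < Real.exp (-κ * s) * (C / 2) := by positivity
      rcases lt_or_ge ‖y‖ c with h | h
      · have := hcM _ hy' h
        have hz3 : Real.exp (-κ * t) * ε * ‖y‖ ^ (-γ) ≤ Real.exp (-κ * s) * (ε * ‖y‖ ^ (-γ)) := by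
          rw [mul_assoc]
          apply mul_le_mul_of_nonneg_right _ (by positivity)
          apply Real.exp_le_exp.2
          nlinarith [hs.2]
        linarith
      · have hd' : ρ < ‖y‖ := by
          by_contra hh
          exact hyK ⟨h, not_lt.1 hh⟩
        have b1 := h2 y hy0 s hs.1
        have b2 := mul_lt_mul_of_pos_left (hbig y hd'.le) (Real.exp_pos (-κ * s))
        linarith
    · intro y hy s hs hveq
      have hy' : 0 < ‖y‖ := hy.1
      have hy0 : y ≠ 0 := by simpa using hy.1.ne'
      have hφ := S.φpos _ hy'
      have hg1 := hg y hy
      beta_reduce at hveq ⊢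
      set E := Real.exp (-κ * s) with hE
      have hEpos : 0 < E := Real.exp_pos _
      set z := E * (C * (1 + -q * ‖y‖ ^ 2)) with hz
      have hzpos : 0 < z := by
        apply mul_pos hEpos; linarith
      have hzC : z ≤ E * C := by
        apply mul_le_mul_of_nonneg_left _ hEpos.le
        have := mul_nonneg (mul_pos hCpos hqpos).le (sq_nonneg ‖y‖)
        linarith
      set z1 := E * (ε * ‖y‖ ^ (-γ)) with hz1
      have hz1pos : 0 < z1 := by positivity
      have hvz : v y s - φ ‖y‖ = z + z1 := by rw [hveq]; ring
      have hcv := convex_bound (p := p) hp.le hφ.le (a := v y s) (by linarith)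
      rw [hvz] at hcv
      have hvp2 : v y s ^ (p - 1) ≤ L ^ (p - 1) / ‖y‖ ^ 2 := by
        rw [← Phi_pow S.hνp hL hy']
        exact Real.rpow_le_rpow (by linarith) (hΦv y hy0 s hs.1.le) (by linarith)
      have hvp3 : v y s ^ (p - 1) ≤ M ^ (p - 1) :=
        Real.rpow_le_rpow (by linarith) (hvM y hy0 s hs.1.le) (by linarith)
      have h5 : (1 + κ) * (p * v y s ^ (p - 1)) * z ≤ q * (E * C) := by
        have : (1 + κ) * (p * v y s ^ (p - 1)) ≤ q := by
          rw [hq]; gcongr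
        exact mul_le_mul this hzC hzpos.le hqpos.le
      have h5' : q * (E * C) < q * (E * C) * (2 * n) := by
        have h1 : 0 < q * (E * C) := by positivity
        have h2 := mul_pos h1 (show (0:ℝ) < 2 * n - 1 by linarith)
        linarith
      have h6 : (1 + κ) * (p * v y s ^ (p - 1)) * z1 ≤
          γ * ((n : ℝ) - 2 - γ) / ‖y‖ ^ 2 * z1 := by
        apply mul_le_mul_of_nonneg_right _ hz1pos.le
        rw [S.hA]
        have : (1 + κ) * (p * L ^ (p - 1)) / ‖y‖ ^ 2 = (1 + κ) * p * (L ^ (p - 1) / ‖y‖ ^ 2) := by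
          ring
        rw [this]
        have := mul_le_mul_of_nonneg_left hvp2 (show 0 ≤ (1 + κ) * p by positivity)
        linarith
      have h7 : E * (ε * (-(γ * ((n : ℝ) - 2 - γ)) * (‖y‖ ^ (-γ) / ‖y‖ ^ 2))) =
          - (γ * ((n : ℝ) - 2 - γ) / ‖y‖ ^ 2 * z1) := by rw [hz1]; ring
      rw [h7]
      have h8 : E * (C * (0 + -q * (2 * n))) = - (q * (E * C) * (2 * n)) := by ring
      rw [h8]
      linarith
  have hc : 0 < Real.exp (-κ * t) * ‖x‖ ^ (-γ) := by positivity
  refine le_of_forall_pos_le_add fun δ hδ => ?_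
  have := key (δ / (Real.exp (-κ * t) * ‖x‖ ^ (-γ))) (by positivity)
  rwa [div_mul_cancel₀ _ hc.ne'] at this


set_option maxHeartbeats 1000000 in
/-- S3a, pushing the solution strictly below the singular steady state -/
lemma step3a {n : ℕ} {p ν L γ κ : ℝ} {φ : ℝ → ℝ} (S : Setup n p ν L γ κ φ)
    {v : EE n → ℝ → ℝ} {v₀ : EE n → ℝ} (hv : IsBddClassicalSol n p v v₀)
    (hΦv : ∀ x : EE n, x ≠ 0 → ∀ t ≥ 0, v x t ≤ L * ‖x‖ ^ (-ν)) {B : ℝ} (hB : 0 < B)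
    (h2 : ∀ x : EE n, x ≠ 0 → ∀ t ≥ 0, v x t ≤ φ ‖x‖ + B * ‖x‖ ^ (-γ))
    {M : ℝ} (hM : ∀ x : EE n, ∀ t ∈ Icc (0:ℝ) 1, v x t ≤ M) :
    ∃ r1 > 0, ∃ R > r1, ∃ δ > 0, (∀ r > 0, r ≤ r1 → M + 1 ≤ L * r ^ (-ν)) ∧
      (∀ x : EE n, ‖x‖ ∈ Icc r1 R → v x 1 ≤ L * ‖x‖ ^ (-ν) - δ) ∧
      (∀ r ∈ Icc R (2 * R), φ r + B * r ^ (-γ) ≤ L * r ^ (-ν) - δ) := by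
  have hL := S.hL
  have hp := S.hp
  have hn : (10 : ℝ) < n := by exact_mod_cast S.hn
  obtain ⟨c', hc', _, hcM⟩ := ptail_small (M := M + 1) S.hν hL
  set r1 := c' / 2 with hr1
  have hr1pos : 0 < r1 := by positivity
  obtain ⟨R', hR', hgap⟩ := S.gap B
  set R := max R' (r1 + 1) with hR
  have hRr : r1 < R := lt_of_lt_of_le (by linarith) (le_max_right _ _)
  have hRpos : 0 < R := hr1pos.trans hRr
  -- minimum of the gap
  obtain ⟨δ, hδ, hδle⟩ : ∃ δ > 0, ∀ r ∈ Icc R (2 * R), φ r + B * r ^ (-γ) ≤ L * r ^ (-ν) - δ := by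
    have hsub : Icc R (2 * R) ⊆ Ioi 0 := fun r hr => lt_of_lt_of_le hRpos hr.1
    have hcont : ContinuousOn (fun r => L * r ^ (-ν) - (φ r + B * r ^ (-γ))) (Icc R (2 * R)) :=
      ((S.RΦ.cont).sub ((S.Rφ.cont).add (((radLap_pow n γ).mul B).cont))).mono hsub
    obtain ⟨r, hr, hmin⟩ := isCompact_Icc.exists_isMinOn
      (nonempty_Icc.2 (by linarith : R ≤ 2 * R)) hcont
    refine ⟨L * r ^ (-ν) - (φ r + B * r ^ (-γ)), ?_, fun s hs => ?_⟩
    · have := hgap r ((le_max_left _ _).trans hr.1)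
      linarith
    · have := hmin hs
      simp only [mem_ofPred_eq] at this
      linarith
  set c := 2 * R with hc
  set P := p * (L ^ (p - 1) / (r1 / 2) ^ 2) with hP
  have hPpos : 0 < P := by positivity
  set k := P * c + ((n:ℝ) - 1) / (r1 / 2) + 1 with hk
  have hk0 : 0 < P * c := by positivity
  have hk1 : 0 < ((n:ℝ) - 1) / (r1 / 2) := div_pos (by linarith) (by linarith)
  have hkpos : 0 < k := by linarith
  set m := min 1 δ with hm
  have hmpos : 0 < m := lt_min one_pos hδ
  set ε := m * Real.exp (-(k * c)) with hε
  have hεpos : 0 < ε := by positivity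
  set G := ε * Real.exp (k * (r1 / 2)) with hG
  have hGpos : 0 < G := by positivity
  have hw : ∀ r t : ℝ, Real.exp (k * c * t) * (-G * Real.exp (-k * r)) =
      -(ε * Real.exp (k * (c * t + r1 / 2 - r))) := by
    intro r t
    have : k * (c * t + r1 / 2 - r) = k * c * t + k * (r1 / 2) + -k * r := by ring
    rw [this, Real.exp_add, Real.exp_add, hG]; ring
  have hwle : ∀ r > r1 / 2, ∀ t ∈ Icc (0:ℝ) 1, ε * Real.exp (k * (c * t + r1 / 2 - r)) ≤ m := by
    intro r hr t ht
    rw [hε, mul_assoc, ← Real.exp_add]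
    have : Real.exp (-(k * c) + k * (c * t + r1 / 2 - r)) ≤ 1 := by
      apply Real.exp_le_one_iff.2
      have : c * t ≤ c := by
        have : 0 < c := by positivity
        nlinarith [ht.2]
      have := mul_le_mul_of_nonneg_left (show c * t + r1 / 2 - r ≤ c by linarith) hkpos.le
      linarith
    nlinarith
  have hRζ := S.RΦ.add (radLap_const n ε)
  have main := cmp_upper hp hv (T := 1) isOpen_Ioo
    (fun r hr => lt_trans (by positivity) hr.1 : Ioo (r1 / 2) (2 * R) ⊆ Ioi 0) r1 R
    (fun r hr => ⟨by linarith [hr.1], by linarith [hr.2]⟩) hRζ ((radLap_exp n k).mul (-G))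
    (radLap_const n 0) (k * c) 0 ?_ ?_ ?_
  · set δ' := min δ (ε * (Real.exp (k * R) - 1)) with hδ'
    have h1 : 0 < ε * (Real.exp (k * R) - 1) := by
      apply mul_pos hεpos
      have : 1 < Real.exp (k * R) := Real.one_lt_exp_iff.2 (by positivity)
      linarith
    refine ⟨r1, hr1pos, R, hRr, δ', lt_min hδ h1, ?_, ?_, ?_⟩
    · intro r hr hrr
      exact (hcM r hr (by linarith)).le
    · intro x hx
      have := main x ⟨by linarith [hx.1], by linarith [hx.2]⟩ 1 ⟨by norm_num, le_refl _⟩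
      beta_reduce at this
      rw [hw] at this
      have h3 : Real.exp (k * R) ≤ Real.exp (k * (c * 1 + r1 / 2 - ‖x‖)) := by
        apply Real.exp_le_exp.2
        apply mul_le_mul_of_nonneg_left _ hkpos.le
        linarith [hx.2]
      have h4 := mul_le_mul_of_nonneg_left h3 hεpos.le
      have h5 : δ' ≤ ε * (Real.exp (k * R) - 1) := min_le_right _ _
      simp only [mul_zero, add_zero] at this
      linarith
    · intro r hr
      have := hδle r hr
      have : δ' ≤ δ := min_le_left _ _
      linarith [hδle r hr]
  · intro y hy
    have hy0 : y ≠ 0 := by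
      have : 0 < ‖y‖ := lt_trans (by positivity) hy.1
      simpa using this
    have h1 := hΦv y hy0 0 le_rfl
    rw [hv.init] at h1
    have h3 := hw ‖y‖ 0
    simp only [mul_zero, Real.exp_zero, one_mul, zero_add] at h3
    beta_reduce
    rw [h3]
    have h4 : Real.exp (k * (r1 / 2 - ‖y‖)) < 1 := by
      apply Real.exp_lt_one_iff.2
      apply mul_neg_of_pos_of_neg hkpos
      linarith [hy.1]
    have := mul_lt_mul_of_pos_left h4 hεpos
    linarith
  · intro y hy hyK s hs
    have hy' : 0 < ‖y‖ := lt_trans (by positivity) hy.1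
    have hy0 : y ≠ 0 := by simpa using hy'
    have h3 := hwle ‖y‖ hy.1 s hs
    beta_reduce
    rw [hw]
    simp only [mul_zero, add_zero]
    rcases lt_or_ge ‖y‖ r1 with h | h
    · have := hcM _ hy' (by linarith)
      have h4 := hM y s hs
      have : m ≤ 1 := min_le_left _ _
      linarith
    · have hd' : R < ‖y‖ := by
        by_contra hh
        exact hyK ⟨h, not_lt.1 hh⟩
      have b1 := h2 y hy0 s hs.1
      have b2 := hδle ‖y‖ ⟨hd'.le, hy.2.le⟩
      have : m ≤ δ := min_le_right _ _
      linarith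
  · intro y hy s hs hveq
    have hy' : 0 < ‖y‖ := lt_trans (by positivity) hy.1
    have hy0 : y ≠ 0 := by simpa using hy'
    have hvΦ := hΦv y hy0 s hs.1.le
    have hv0 := hv.nonneg y s hs.1.le
    have h1 : v y s ^ p ≤ (L * ‖y‖ ^ (-ν)) ^ p := Real.rpow_le_rpow hv0 hvΦ (by linarith)
    have hvp2 : v y s ^ (p - 1) ≤ L ^ (p - 1) / ‖y‖ ^ 2 := by
      rw [← Phi_pow S.hνp hL hy']
      exact Real.rpow_le_rpow hv0 hvΦ (by linarith)
    have hvp3 : L ^ (p - 1) / ‖y‖ ^ 2 ≤ L ^ (p - 1) / (r1 / 2) ^ 2 := by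
      have := hy.1
      gcongr
    have hvP : p * v y s ^ (p - 1) ≤ P := by
      rw [hP]
      exact mul_le_mul_of_nonneg_left (hvp2.trans hvp3) (by linarith)
    have h5 : ((n:ℝ) - 1) / ‖y‖ ≤ ((n:ℝ) - 1) / (r1 / 2) := by
      have := hy.1
      have : (0:ℝ) ≤ n - 1 := by linarith
      gcongr
    beta_reduce
    set W := Real.exp (k * c * s) * (-G * Real.exp (-k * ‖y‖)) with hW
    have hWneg : W < 0 := by
      rw [hW, hw]
      have : 0 < ε * Real.exp (k * (c * s + r1 / 2 - ‖y‖)) := by positivity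
      linarith
    have e1 : Real.exp (k * c * s) * (-G * ((k ^ 2 - ((n:ℝ) - 1) / ‖y‖ * k) * Real.exp (-k * ‖y‖)))
        = (k ^ 2 - ((n:ℝ) - 1) / ‖y‖ * k) * W := by rw [hW]; ring
    rw [e1]
    have h6 : p * v y s ^ (p - 1) * (k * c) < k ^ 2 - ((n:ℝ) - 1) / ‖y‖ * k := by
      have a1 : p * v y s ^ (p - 1) * c ≤ P * c := mul_le_mul_of_nonneg_right hvP (by positivity)
      have a2 : p * v y s ^ (p - 1) * c + ((n:ℝ) - 1) / ‖y‖ < k := by linarith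
      have := mul_lt_mul_of_pos_right a2 hkpos
      linarith
    have h7 := mul_lt_mul_of_neg_right h6 hWneg
    simp only [mul_zero, add_zero]
    linarith

/-- S3b -/
lemma step3 {n : ℕ} {p ν L γ κ : ℝ} {φ : ℝ → ℝ} (S : Setup n p ν L γ κ φ)
    {v : EE n → ℝ → ℝ} {v₀ : EE n → ℝ} (hv : IsBddClassicalSol n p v v₀)
    (hΦv : ∀ x : EE n, x ≠ 0 → ∀ t ≥ 0, v x t ≤ L * ‖x‖ ^ (-ν)) {B : ℝ} (hB : 0 < B)
    (h2 : ∀ x : EE n, x ≠ 0 → ∀ t ≥ 0, v x t ≤ φ ‖x‖ + B * ‖x‖ ^ (-γ)) :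
    ∃ M > 0, ∀ x : EE n, x ≠ 0 → ∀ t ≥ 0, v x t ≤ M := by
  have hL := S.hL
  have hp := S.hp
  have hn : (10 : ℝ) < n := by exact_mod_cast S.hn
  have hγ0 : 0 < γ := S.hν.trans S.hγ
  obtain ⟨M, hM⟩ := hv.bdd 1 one_pos
  have hM0 : 0 ≤ M := (hv.nonneg 0 0 le_rfl).trans (hM 0 0 ⟨le_rfl, zero_le_one⟩)
  obtain ⟨r1, hr1, R, hR, δ, hδ, ha, hb, hcc⟩ := step3a S hv hΦv hB h2 hM
  have hRpos : 0 < R := hr1.trans hR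
  set Φ1 := L * r1 ^ (-ν) with hΦ1
  have hΦ1pos : 0 < Φ1 := by positivity
  have hΦ1M : M + 1 ≤ Φ1 := ha r1 hr1 le_rfl
  -- choice of θ
  set τ := min (δ / (2 * Φ1)) (1 / (2 * Φ1)) with hτ
  have hτpos : 0 < τ := by positivity
  have hτ1 : τ * Φ1 < δ := by
    have : τ ≤ δ / (2 * Φ1) := min_le_left _ _
    rw [le_div_iff₀ (by positivity)] at this
    linarith
  have hτ2 : τ * Φ1 < 1 := by
    have : τ ≤ 1 / (2 * Φ1) := min_le_right _ _
    rw [le_div_iff₀ (by positivity)] at this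
    linarith
  obtain ⟨s0, hs0, hrat⟩ := S.ratio (1 - τ) (by linarith)
  set μ := s0 / r1 with hμ
  have hμpos : 0 < μ := by positivity
  set ζ : ℝ → ℝ := fun r => μ ^ ν * φ (μ * r) with hζ
  have hζle : ∀ r ≥ r1, (1 - τ) * (L * r ^ (-ν)) ≤ ζ r := by
    intro r hr
    have hr0 : 0 < r := hr1.trans_le hr
    have h := hrat (μ * r) (by
      have : μ * r1 = s0 := by rw [hμ]; field_simp
      rw [← this]
      exact mul_le_mul_of_nonneg_left hr hμpos.le)
    have h' := mul_le_mul_of_nonneg_left h (Real.rpow_nonneg hμpos.le ν)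
    have e : μ ^ ν * (μ * r) ^ (-ν) = r ^ (-ν) := by
      rw [Real.mul_rpow hμpos.le hr0.le, Real.rpow_neg hμpos.le, ← mul_assoc,
        mul_inv_cancel₀ (Real.rpow_pos_of_pos hμpos ν).ne', one_mul]
    calc (1 - τ) * (L * r ^ (-ν)) = μ ^ ν * ((1 - τ) * (L * (μ * r) ^ (-ν))) := by
          rw [← e]; ring
      _ ≤ _ := h'
  have hΦanti : ∀ r ≥ r1, L * r ^ (-ν) ≤ Φ1 := by
    intro r hr
    have := S.hν
    exact mul_le_mul_of_nonneg_left (Real.rpow_le_rpow_of_nonpos hr1 hr (by linarith)) hL.le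
  have hζδ : ∀ r ≥ r1, L * r ^ (-ν) - δ < ζ r := by
    intro r hr
    have h1 := hζle r hr
    have h3 := mul_le_mul_of_nonneg_left (hΦanti r hr) hτpos.le
    linarith
  have hζM : ∀ r > 0, r ≤ r1 → M < ζ r := by
    intro r hr hrr
    have h1 := hζle r1 le_rfl
    have h3 : ζ r1 ≤ ζ r := by
      apply mul_le_mul_of_nonneg_left _ (Real.rpow_nonneg hμpos.le ν)
      exact S.anti _ (mul_pos hμpos hr) _ (mul_le_mul_of_nonneg_left hrr hμpos.le)
    have : (1 - τ) * Φ1 = Φ1 - τ * Φ1 := by ring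
    rw [← hΦ1, this] at h1
    linarith
  have hζpos : ∀ r > 0, 0 < ζ r := fun r hr =>
    mul_pos (Real.rpow_pos_of_pos hμpos ν) (S.φpos _ (mul_pos hμpos hr))
  have hRζ : RadLap n ζ (fun r => - (ζ r) ^ p) := scaled_steady S.hνp hμpos S.φpos S.Rφ
  have hw := time_shift hv (t0 := 1) zero_le_one
  have hmain : ∀ x : EE n, ‖x‖ ∈ Ioo 0 (2 * R) → ∀ t ≥ 0, v x (1 + t) ≤ ζ ‖x‖ := by
    intro x hx t ht
    obtain ⟨MT, hMT⟩ := hw.bdd (t + 1) (by linarith)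
    have hx' : 0 < ‖x‖ := hx.1
    have key : ∀ ε > 0, v x (1 + t) ≤ ζ ‖x‖ + ε * (Real.exp (1 * t) * ‖x‖ ^ (-γ)) := by
      intro ε hε
      obtain ⟨c, hc, hc1, hcM⟩ := ptail_small (M := MT) hγ0 hε
      have := cmp_upper hp hw (T := t) isOpen_Ioo
        (fun r hr => hr.1 : Ioo (0:ℝ) (2 * R) ⊆ Ioi 0) c R
        (fun r hr => ⟨lt_of_lt_of_le hc hr.1, by linarith [hr.2]⟩) hRζ ((radLap_pow n γ).mul ε)
        (radLap_const n 0) 1 0 ?_ ?_ ?_ x hx t ⟨ht, le_refl _⟩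
      · simp only [mul_zero, add_zero] at this
        linarith
      · intro y hy
        have hy' := hy.1
        have hy0 : y ≠ 0 := by simpa using hy'.ne'
        have a3 : 0 < ε * ‖y‖ ^ (-γ) := by positivity
        beta_reduce
        rcases le_or_gt ‖y‖ r1 with h | h
        · have := hζM _ hy' h
          have := hM y 1 ⟨by norm_num, le_refl _⟩
          linarith
        · rcases le_or_gt ‖y‖ R with h' | h'
          · have := hb y ⟨h.le, h'⟩
            have := hζδ _ h.le
            linarith
          · have := h2 y hy0 1 (by norm_num)
            have := hcc _ ⟨h'.le, hy.2.le⟩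
            have := hζδ _ h.le
            linarith
      · intro y hy hyK s hs
        have hy' := hy.1
        have hy0 : y ≠ 0 := by simpa using hy'.ne'
        have a3 : 0 < ε * ‖y‖ ^ (-γ) := by positivity
        have a4 : 1 ≤ Real.exp (1 * s) := Real.one_le_exp (by linarith [hs.1])
        have a5 : ε * ‖y‖ ^ (-γ) ≤ Real.exp (1 * s) * (ε * ‖y‖ ^ (-γ)) := by nlinarith
        have a6 := hζpos _ hy'
        simp only [mul_zero, add_zero]
        rcases lt_or_ge ‖y‖ c with h | h
        · have := hcM _ hy' h
          have := hMT y s ⟨hs.1, by linarith [hs.2]⟩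
          linarith
        · have hd' : R < ‖y‖ := by
            by_contra hh
            exact hyK ⟨h, not_lt.1 hh⟩
          have := h2 y hy0 (1 + s) (by linarith [hs.1])
          have := hcc _ ⟨hd'.le, hy.2.le⟩
          have := hζδ ‖y‖ (by linarith)
          linarith
      · intro y hy s hs hveq
        have hy' := hy.1
        have hζ0 := hζpos _ hy'
        simp only [mul_zero, add_zero] at hveq ⊢
        set w := v y (1 + s) with hw
        set z := Real.exp (1 * s) * (ε * ‖y‖ ^ (-γ)) with hz
        have hzpos : 0 < z := by positivity
        have hvz : w - ζ ‖y‖ = z := by rw [hveq]; ring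
        have hcv := convex_bound (p := p) hp.le hζ0.le (a := w) (by linarith)
        rw [hvz] at hcv
        have h7 : Real.exp (1 * s) * (ε * (-(γ * ((n : ℝ) - 2 - γ)) * (‖y‖ ^ (-γ) / ‖y‖ ^ 2))) =
          - (γ * ((n : ℝ) - 2 - γ) / ‖y‖ ^ 2 * z) := by rw [hz]; ring
        rw [h7]
        have h8 : 0 < γ * ((n : ℝ) - 2 - γ) / ‖y‖ ^ 2 * z := by
          have := S.hγ2
          have : 0 < (n:ℝ) - 2 - γ := by linarith
          positivity
        linarith
    have hc : 0 < Real.exp (1 * t) * ‖x‖ ^ (-γ) := by positivity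
    refine le_of_forall_pos_le_add fun δ hδ => ?_
    have := key (δ / (Real.exp (1 * t) * ‖x‖ ^ (-γ))) (by positivity)
    rwa [div_mul_cancel₀ _ hc.ne'] at this
  obtain ⟨α, hα, hφα⟩ := S.φbd
  have q1 : 0 < μ ^ ν * α := by positivity
  refine ⟨M + μ ^ ν * α + Φ1, by positivity, fun x hx t ht => ?_⟩
  have hx' : 0 < ‖x‖ := by simpa using hx
  rcases le_or_gt t 1 with h | h
  · have := hM x t ⟨ht, h⟩
    linarith
  · rcases lt_or_ge ‖x‖ (2 * R) with h' | h'
    · have := hmain x ⟨hx', h'⟩ (t - 1) (by linarith)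
      have e : 1 + (t - 1) = t := by ring
      rw [e] at this
      have h3 : ζ ‖x‖ ≤ μ ^ ν * α :=
        mul_le_mul_of_nonneg_left (hφα _ (mul_pos hμpos hx')) (by positivity)
      linarith
    · have := hΦv x hx t ht
      have := hΦanti ‖x‖ (by linarith)
      linarith


lemma bump_lb {n : ℕ} (hn : 10 < n) {ρ r : ℝ} (hρ : 0 < ρ) (hr : 0 < r)
    (hy : 0 ≤ 1 / 4 - (r / ρ - 1) ^ 2) :
    (2 * n - 2 * n * (4 * n + 8) * (1 / 4 - (r / ρ - 1) ^ 2)) / ρ ^ 2 ≤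
      (-2 / ρ ^ 2) * (1 + 4 * n * (1 / 4 - (r / ρ - 1) ^ 2))
      + 4 * n * (-2 * (r / ρ - 1) / ρ) ^ 2
      + ((n : ℝ) - 1) / r * (-2 * (r / ρ - 1) / ρ * (1 + 4 * n * (1 / 4 - (r / ρ - 1) ^ 2))) := by
  have hn' : (10 : ℝ) < n := by exact_mod_cast hn
  obtain ⟨s, hs⟩ : ∃ s, s = r / ρ := ⟨_, rfl⟩
  have hrs : r = s * ρ := by rw [hs]; field_simp
  have hspos : 0 < s := by rw [hs]; positivity
  rw [← hs] at hy ⊢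
  have hs1 : (s - 1) / s ≤ 1 := by
    rw [div_le_one hspos]; linarith
  set y := 1 / 4 - (s - 1) ^ 2 with hyd
  have e1 : ((n : ℝ) - 1) / r * (-2 * (s - 1) / ρ * (1 + 4 * n * y)) =
      (-2 * (n - 1) * ((s - 1) / s) * (1 + 4 * n * y)) / ρ ^ 2 := by
    rw [hrs]; field_simp
  have e2 : 4 * (n:ℝ) * (-2 * (s - 1) / ρ) ^ 2 = (16 * n * (1 / 4 - y)) / ρ ^ 2 := by
    rw [hyd]; field_simp; ring
  have e3 : (-2 / ρ ^ 2) * (1 + 4 * n * y) = (-2 * (1 + 4 * n * y)) / ρ ^ 2 := by ring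
  rw [e1, e2, e3, ← add_div, ← add_div]
  apply div_le_div_of_nonneg_right _ (by positivity)
  have h1 : 0 ≤ 1 + 4 * (n:ℝ) * y := by positivity
  have h2 : 0 ≤ 2 * ((n:ℝ) - 1) * (1 + 4 * n * y) := mul_nonneg (by linarith) h1
  have h3 := mul_le_mul_of_nonneg_left hs1 h2
  nlinarith

set_option maxHeartbeats 1000000 in
/-- S5, short time lower bound near infinity -/
lemma step5 {n : ℕ} {p ν L γ κ : ℝ} {φ : ℝ → ℝ} (S : Setup n p ν L γ κ φ) :
    ∃ c > 0, ∃ τ > 0, ∀ (v : EE n → ℝ → ℝ) (v₀ : EE n → ℝ), IsBddClassicalSol n p v v₀ →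
      ∀ R > 0, (∀ x : EE n, R ≤ ‖x‖ → 1 / 4 * (L * ‖x‖ ^ (-ν)) ≤ v₀ x) →
      ∀ x : EE n, 3 * R ≤ ‖x‖ → ∀ t ∈ Icc 0 τ, c * (L * ‖x‖ ^ (-ν)) ≤ v x t := by
  have hL := S.hL
  have hp := S.hp
  have hν := S.hν
  have hn : (10 : ℝ) < n := by exact_mod_cast S.hn
  set θ : ℝ := 2 ^ (-ν) / (4 * n) with hθ
  have hθpos : 0 < θ := by positivity
  set y0 : ℝ := 1 / (4 * n + 8) with hy0
  have hy0pos : 0 < y0 := by positivity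
  set Q : ℝ := (Real.exp (-1) * θ * y0) ^ (p - 1) * L ^ (p - 1) with hQ
  have hQpos : 0 < Q := by positivity
  set K : ℝ := 2 * n * (4 * n + 8) / (p * Q) with hK
  have hKpos : 0 < K := by positivity
  have hKQ : p * K * Q = 2 * n * (4 * n + 8) := by
    rw [hK]; field_simp
  refine ⟨Real.exp (-1) * θ / 4, by positivity, 1 / K, by positivity, ?_⟩
  intro v v₀ hv R hR h0 x hx t ht
  have hexp : ∀ s ∈ Icc 0 (1 / K), Real.exp (-1) ≤ Real.exp (-K * s) := by
    intro s hs
    apply Real.exp_le_exp.2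
    have := hs.2
    rw [le_div_iff₀ hKpos] at this
    linarith
  obtain ⟨ρ, hρd⟩ : ∃ ρ, ρ = ‖x‖ := ⟨_, rfl⟩
  rw [← hρd] at hx
  have hρ : 0 < ρ := by linarith
  set m : ℝ := θ * (L * ρ ^ (-ν)) with hm
  have hmpos : 0 < m := by positivity
  set ι : ℝ := 1 / (8 * n) with hι
  have hιpos : 0 < ι := by positivity
  have hιn : ι * (8 * n) = 1 := by rw [hι]; field_simp
  have hι1 : ι < 1 / 80 := by nlinarith
  -- the function y
  have hylow : ∀ r ∈ Ioo (ρ * (1 / 2 - ι)) (ρ * (3 / 2 + ι)),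
      0 < 1 + 2 * n * (1 / 4 - (r / ρ - 1) ^ 2) := by
    intro r hr
    have a1 : 1 / 2 - ι < r / ρ := by rw [lt_div_iff₀ hρ]; linarith [hr.1]
    have a2 : r / ρ < 3 / 2 + ι := by rw [div_lt_iff₀ hρ]; linarith [hr.2]
    have a3 : (r / ρ - 1) ^ 2 ≤ (1 / 2 + ι) ^ 2 := by
      apply sq_le_sq'
      · linarith
      · linarith
    have a4 : (1 / 2 + ι) ^ 2 ≤ 1 / 4 + 2 * ι := by nlinarith
    have a5 : -(2 * ι) ≤ 1 / 4 - (r / ρ - 1) ^ 2 := by linarith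
    have a6 := mul_le_mul_of_nonneg_left a5 (show (0:ℝ) ≤ 2 * n by linarith)
    linarith
  have hneg : ∀ r ∈ Ioo (ρ * (1 / 2 - ι)) (ρ * (3 / 2 + ι)), 1 / 4 - (r / ρ - 1) ^ 2 < 0 →
      (1 / 4 - (r / ρ - 1) ^ 2) + 2 * n * (1 / 4 - (r / ρ - 1) ^ 2) ^ 2 < 0 := by
    intro r hr hy
    have := mul_neg_of_neg_of_pos hy (hylow r hr)
    linarith
  have main := cmp_lower hp hv (T := 1 / K) isOpen_Ioo
    (fun r hr => lt_trans (by apply mul_pos hρ; linarith) hr.1 :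
      Ioo (ρ * (1 / 2 - ι)) (ρ * (3 / 2 + ι)) ⊆ Ioi 0) (ρ / 2) (3 * ρ / 2)
    (fun r hr => ⟨by have := mul_pos hρ hιpos; linarith [hr.1],
      by have := mul_pos hρ hιpos; linarith [hr.2]⟩) (radLap_const n 0)
    ((radLap_bump n ρ).mul m) (radLap_const n 0) (-K) 0 ?_ ?_ ?_ x
    (by rw [← hρd]; constructor <;> nlinarith) t ht
  · simp only [mul_zero, add_zero, zero_add] at main
    rw [← hρd, div_self hρ.ne', sub_self] at main
    rw [← hρd]
    have h1 := hexp t ht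
    have h2 : m * (1 / 4) ≤ m * (1 / 4 - 0 ^ 2 + 2 * n * (1 / 4 - 0 ^ 2) ^ 2) := by
      apply mul_le_mul_of_nonneg_left _ hmpos.le
      nlinarith
    have h3 : Real.exp (-1) * (m * (1 / 4)) ≤
        Real.exp (-K * t) * (m * (1 / 4 - 0 ^ 2 + 2 * n * (1 / 4 - 0 ^ 2) ^ 2)) :=
      mul_le_mul h1 h2 (by positivity) (Real.exp_pos _).le
    have e : Real.exp (-1) * θ / 4 * (L * ρ ^ (-ν)) = Real.exp (-1) * (m * (1 / 4)) := by
      rw [hm]; ring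
    rw [e]
    linarith
  · intro z hz
    have hz1 : ρ * (3 / 8) < ‖z‖ := by nlinarith [hz.1]
    have hz2 : ‖z‖ < 2 * ρ := by nlinarith [hz.2]
    have hzpos : 0 < ‖z‖ := lt_trans (by positivity) hz1
    have hv1 := h0 z (by linarith)
    have hr := Real.rpow_le_rpow_of_nonpos hzpos hz2.le (show -ν ≤ 0 by linarith)
    rw [Real.mul_rpow (by norm_num) hρ.le] at hr
    have hg : (1 / 4 - (‖z‖ / ρ - 1) ^ 2) + 2 * n * (1 / 4 - (‖z‖ / ρ - 1) ^ 2) ^ 2 < n := by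
      rcases lt_or_ge (1 / 4 - (‖z‖ / ρ - 1) ^ 2) 0 with h | h
      · linarith [hneg _ hz h]
      · have h2 : 1 / 4 - (‖z‖ / ρ - 1) ^ 2 ≤ 1 / 4 := by linarith [sq_nonneg (‖z‖ / ρ - 1)]
        set y := 1 / 4 - (‖z‖ / ρ - 1) ^ 2
        have h3 : y ^ 2 ≤ 1 / 16 := by nlinarith
        have h4 := mul_le_mul_of_nonneg_left h3 (show (0:ℝ) ≤ 2 * n by linarith)
        linarith
    have h3 := mul_lt_mul_of_pos_left hg hmpos
    have e : m * n = 1 / 4 * (L * (2 ^ (-ν) * ρ ^ (-ν))) := by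
      rw [hm, hθ]; field_simp
    have h4 := mul_le_mul_of_nonneg_left hr hL.le
    simp only [add_zero, zero_add]
    linarith
  · intro z hz hzK s hs
    have hy : 1 / 4 - (‖z‖ / ρ - 1) ^ 2 < 0 := by
      by_contra h
      apply hzK
      have h1 : (‖z‖ / ρ - 1) ^ 2 ≤ (1 / 2) ^ 2 := by linarith
      have h2 := abs_le_of_sq_le_sq' h1 (by norm_num)
      have e : ‖z‖ = (‖z‖ / ρ) * ρ := by field_simp
      constructor
      · rw [e]; nlinarith [h2.1]
      · rw [e]; nlinarith [h2.2]
    have h1 := hneg _ hz hy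
    have h2 := mul_neg_of_pos_of_neg (mul_pos (Real.exp_pos (-K * s)) hmpos) h1
    have h3 := hv.nonneg z s hs.1
    simp only [mul_zero, add_zero, zero_add]
    linarith
  · intro z hz s hs hveq
    have hz1 : ρ * (3 / 8) < ‖z‖ := by nlinarith [hz.1]
    have hzpos : 0 < ‖z‖ := lt_trans (by positivity) hz1
    have hv0 := hv.nonneg z s hs.1.le
    simp only [mul_zero, add_zero, zero_add] at hveq ⊢
    have hy : 0 ≤ 1 / 4 - (‖z‖ / ρ - 1) ^ 2 := by
      by_contra h
      have h1 := hneg _ hz (not_le.1 h)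
      have h2 := mul_neg_of_pos_of_neg (mul_pos (Real.exp_pos (-K * s)) hmpos) h1
      linarith
    have hlb := bump_lb S.hn hρ hzpos hy
    set y := 1 / 4 - (‖z‖ / ρ - 1) ^ 2 with hyd
    obtain ⟨H, hH⟩ : ∃ H, H = (-2 / ρ ^ 2) * (1 + 4 * n * y) + 4 * n * (-2 * (‖z‖ / ρ - 1) / ρ) ^ 2
      + ((n : ℝ) - 1) / ‖z‖ * (-2 * (‖z‖ / ρ - 1) / ρ * (1 + 4 * n * y)) := ⟨_, rfl⟩
    rw [← hH] at hlb ⊢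
    set E := Real.exp (-K * s) with hE
    have hEpos : 0 < E := Real.exp_pos _
    set g := y + 2 * n * y ^ 2 with hg
    have hgy : y ≤ g := by
      have : 0 ≤ 2 * n * y ^ 2 := by positivity
      linarith
    have hvp : 0 ≤ v z s ^ (p - 1) := Real.rpow_nonneg hv0 _
    have hsplit := rpow_split hv0 hp
    have e0 : p * v z s ^ (p - 1) * (-K * (E * (m * g))) = -(p * K * v z s ^ p) := by
      rw [hsplit, ← hveq]; ring
    rw [e0]
    have hvpp : 0 ≤ v z s ^ p := Real.rpow_nonneg hv0 _
    have hn8 : (0:ℝ) < 4 * n + 8 := by linarith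
    rcases lt_or_ge y y0 with h | h
    · have hH0 : 0 < H := by
        refine lt_of_lt_of_le ?_ hlb
        apply div_pos _ (by positivity)
        rw [hy0, lt_div_iff₀ hn8] at h
        have := mul_lt_mul_of_pos_left h (show (0:ℝ) < 2 * n by linarith)
        linarith
      have : 0 < E * (m * H) := by positivity
      have : 0 ≤ p * K * v z s ^ p := by positivity
      linarith
    · have hH0 : -(2 * n * (4 * n + 8) * y) / ρ ^ 2 < H := by
        refine lt_of_lt_of_le ?_ hlb
        apply div_lt_div_of_pos_right _ (by positivity)
        linarith
      have hvlow : Real.exp (-1) * θ * y0 * (L * ρ ^ (-ν)) ≤ v z s := by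
        rw [hveq]
        have e : Real.exp (-1) * θ * y0 * (L * ρ ^ (-ν)) = Real.exp (-1) * (m * y0) := by
          rw [hm]; ring
        rw [e]
        apply mul_le_mul (hexp s ⟨hs.1.le, hs.2⟩) _ (by positivity) hEpos.le
        exact mul_le_mul_of_nonneg_left (h.trans hgy) hmpos.le
      have hvQ : Q / ρ ^ 2 ≤ v z s ^ (p - 1) := by
        have h1 := Real.rpow_le_rpow (by positivity) hvlow (show 0 ≤ p - 1 by linarith)
        rw [Real.mul_rpow (by positivity) (by positivity), Phi_pow S.hνp hL hρ] at h1
        rw [hQ]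
        linarith [h1, mul_div_assoc ((Real.exp (-1) * θ * y0) ^ (p - 1)) (L ^ (p - 1)) (ρ ^ 2)]
      have h2 : 2 * n * (4 * n + 8) * y / ρ ^ 2 ≤ p * K * (v z s ^ (p - 1) * g) := by
        have e : 2 * n * (4 * n + 8) * y / ρ ^ 2 = p * K * ((Q / ρ ^ 2) * y) := by
          rw [← hKQ]; ring
        rw [e]
        apply mul_le_mul_of_nonneg_left _ (by positivity)
        exact mul_le_mul hvQ hgy hy hvp
      have h3 : 0 < H + p * K * (v z s ^ (p - 1) * g) := by
        rw [neg_div] at hH0; linarith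
      have h4 := mul_pos (mul_pos hEpos hmpos) h3
      have h5 : p * K * v z s ^ p = E * m * (p * K * (v z s ^ (p - 1) * g)) := by
        rw [hsplit]
        nth_rewrite 2 [hveq]
        ring
      rw [h5]
      linarith


lemma rpow_ne_le {r R s : ℝ} (hr : 0 < r) (h : r ≤ R) (hs : 0 ≤ s) : R ^ (-s) ≤ r ^ (-s) :=
  Real.rpow_le_rpow_of_nonpos hr h (by linarith)

/-- data bounded below by the algebraic barrier is large near infinity -/
lemma lower_far {n : ℕ} {p ν L γ κ : ℝ} {φ : ℝ → ℝ} (S : Setup n p ν L γ κ φ)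
    {γ' D : ℝ} (hγ' : γ < γ') (hD : 0 < D) :
    ∃ R > 0, ∀ r ≥ R, 1 / 4 * (L * r ^ (-ν)) ≤ φ r - D * (r ^ (-γ) + r ^ (-γ')) := by
  have hL := S.hL
  obtain ⟨s0, hs0, h⟩ := S.ratio (1/2) (by norm_num)
  obtain ⟨R1, hR1, h1⟩ := ptail_large (s := γ - ν) (B := 2 * D) (ε := L / 4)
    (by linarith [S.hγ]) (by positivity)
  refine ⟨max s0 R1, lt_max_of_lt_left hs0, fun r hr => ?_⟩
  have hr1 : R1 ≤ r := (le_max_right _ _).trans hr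
  have hr0 : 0 < r := by linarith
  have a1 := h r ((le_max_left _ _).trans hr)
  have a2 := h1 r hr1
  have a3 : r ^ (-γ') ≤ r ^ (-γ) :=
    Real.rpow_le_rpow_of_exponent_le (by linarith) (by linarith)
  have a4 : r ^ (-γ) = r ^ (-(γ - ν)) * r ^ (-ν) := by
    rw [← Real.rpow_add hr0]; ring_nf
  have a5 : 0 < r ^ (-ν) := by positivity
  have a6 := mul_lt_mul_of_pos_right a2 a5
  have a7 : D * (r ^ (-γ) + r ^ (-γ')) ≤ 2 * D * (r ^ (-(γ - ν)) * r ^ (-ν)) := by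
    rw [← a4]; nlinarith
  linarith

set_option maxHeartbeats 1000000 in
/-- S6, one time step -/
lemma step6 {n : ℕ} {p ν L γ κ : ℝ} {φ : ℝ → ℝ} (S : Setup n p ν L γ κ φ)
    {γ' : ℝ} (hγ' : γ < γ') (hγ2 : γ' < ((n:ℝ) - 2) / 2) :
    ∃ τ > 0, ∀ (v : EE n → ℝ → ℝ) (v₀ : EE n → ℝ), IsBddClassicalSol n p v v₀ →
      ∀ D > 0, (∀ x : EE n, x ≠ 0 → φ ‖x‖ - D * (‖x‖ ^ (-γ) + ‖x‖ ^ (-γ')) ≤ v₀ x) →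
      ∀ x : EE n, x ≠ 0 → ∀ t ∈ Icc 0 τ,
        φ ‖x‖ - Real.exp (-κ * t) * (D * (‖x‖ ^ (-γ) + ‖x‖ ^ (-γ'))) ≤ v x t := by
  obtain ⟨c, hc, τ, hτ, hS5⟩ := step5 S
  refine ⟨τ, hτ, ?_⟩
  intro v v₀ hv D hD h0 x hx t ht
  have hL := S.hL
  have hp := S.hp
  have hκ := S.hκ
  have hγ0 : 0 < γ := S.hν.trans S.hγ
  have hγ0' : 0 < γ' := hγ0.trans hγ'
  have hn : (10 : ℝ) < n := by exact_mod_cast S.hn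
  obtain ⟨α, hα, hφα⟩ := S.φbd
  obtain ⟨R, hR, hRlow⟩ := lower_far S hγ' hD
  have hfar := hS5 v v₀ hv R hR (fun y hy => by
    have hy0 : y ≠ 0 := by
      have : 0 < ‖y‖ := by linarith
      simpa using this
    exact (hRlow _ hy).trans (h0 y hy0))
  set A := γ * ((n : ℝ) - 2 - γ) with hAd
  set A' := γ' * ((n : ℝ) - 2 - γ') with hA'd
  have hAA : A < A' := by rw [hAd, hA'd]; nlinarith
  have hApos : 0 < A := by
    rw [hAd]; exact mul_pos hγ0 (by linarith [S.hγ2])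
  set K : ℝ := 1 / c ^ (p - 1) with hK
  have hKpos : 0 < K := by positivity
  have hKc : K * c ^ (p - 1) = 1 := by rw [hK]; field_simp
  set R1 := 3 * R with hR1
  have hR1pos : 0 < R1 := by positivity
  set rhs := Real.exp (-κ * τ) * D * (A' - A) * (R1 ^ (-γ') / R1 ^ 2) with hrhs
  have hAA' : 0 < A' - A := by linarith
  have hrhspos : 0 < rhs := by positivity
  set ε0 := rhs / (p * α ^ (p - 1) * Real.exp (K * τ)) with hε0
  have hε0pos : 0 < ε0 := by positivity
  have hx' : 0 < ‖x‖ := by simpa using hx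
  have key : ∀ ε > 0, ε < ε0 → φ ‖x‖ - Real.exp (-κ * t) * (D * (‖x‖ ^ (-γ) + ‖x‖ ^ (-γ')))
      - ε * Real.exp (K * t) < v x t := by
    intro ε hε hεε
    obtain ⟨c1, hc1, hc1', hcM⟩ := ptail_small (M := α) hγ0
      (show 0 < Real.exp (-κ * τ) * D by positivity)
    obtain ⟨d, hd, hdM⟩ := ptail_large (B := L) S.hν hε
    have := cmp_lower hp hv (T := τ) isOpen_Ioi (subset_refl (Ioi (0:ℝ))) c1 d
      (fun r hr => lt_of_lt_of_le hc1 hr.1) S.Rφ (((radLap_pow n γ).add (radLap_pow n γ')).mul (-D))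
      (radLap_const n (-ε)) (-κ) K ?_ ?_ ?_ x (by simpa using hx) t ht
    · linarith
    · intro y hy
      have hy0 : y ≠ 0 := by simpa using hy
      have := h0 y hy0
      linarith
    · intro y hy hyK s hs
      have hy' : 0 < ‖y‖ := hy
      have hv0 := hv.nonneg y s hs.1
      have he : 1 ≤ Real.exp (K * s) := Real.one_le_exp (mul_nonneg (by linarith) hs.1)
      have hz1 : ε ≤ Real.exp (K * s) * ε := by nlinarith
      have hz2 : 0 < Real.exp (-κ * s) * (D * ‖y‖ ^ (-γ)) := by positivity
      have hz4 : 0 < Real.exp (-κ * s) * (D * ‖y‖ ^ (-γ')) := by positivity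
      have hz3 : Real.exp (-κ * τ) * D * ‖y‖ ^ (-γ) ≤ Real.exp (-κ * s) * (D * ‖y‖ ^ (-γ)) := by
        rw [mul_assoc]
        apply mul_le_mul_of_nonneg_right _ (by positivity)
        apply Real.exp_le_exp.2
        nlinarith [hs.2]
      rcases lt_or_ge ‖y‖ c1 with h | h
      · have := hcM _ hy' h
        have := hφα _ hy'
        linarith
      · have hd' : d < ‖y‖ := by
          by_contra hh
          exact hyK ⟨h, not_lt.1 hh⟩
        have h2 := hdM _ hd'.le
        have := S.φle _ hy'
        linarith
    · intro y hy s hs hveq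
      have hy' : 0 < ‖y‖ := hy
      have hy0 : y ≠ 0 := by simpa using hy
      have hφ := S.φpos _ hy'
      have hv0 := hv.nonneg y s hs.1.le
      beta_reduce at hveq ⊢
      set E := Real.exp (K * s) with hE
      have hEpos : 0 < E := Real.exp_pos _
      set F := Real.exp (-κ * s) with hF
      have hFpos : 0 < F := Real.exp_pos _
      set X := ‖y‖ ^ (-γ) with hX
      set Y := ‖y‖ ^ (-γ') with hY
      have hXpos : 0 < X := by positivity
      have hYpos : 0 < Y := by positivity
      set z2 := E * ε with hz2
      have hz2pos : 0 < z2 := by positivity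
      set z1 := F * (D * (X + Y)) with hz1
      have hz1pos : 0 < z1 := by positivity
      have hvz : φ ‖y‖ - v y s = z1 + z2 := by rw [hveq]; ring
      have hcv := convex_bound (p := p) hp.le hv0 (a := φ ‖y‖) (by linarith)
      rw [hvz] at hcv
      set ψ := φ ‖y‖ ^ (p - 1) with hψ
      set u := v y s ^ (p - 1) with hu
      have hu0 : 0 ≤ u := Real.rpow_nonneg hv0 _
      have huψ : u ≤ ψ := Real.rpow_le_rpow hv0 (by linarith) (by linarith)
      have hψL : ψ ≤ L ^ (p - 1) / ‖y‖ ^ 2 := by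
        rw [← Phi_pow S.hνp hL hy']
        exact Real.rpow_le_rpow hφ.le (S.φle _ hy') (by linarith)
      have hψα : ψ ≤ α ^ (p - 1) := Real.rpow_le_rpow hφ.le (hφα _ hy') (by linarith)
      have h6 : κ * (p * u) * z1 + p * ψ * z1 ≤ A / ‖y‖ ^ 2 * z1 := by
        have a1 : κ * (p * u) ≤ κ * (p * ψ) := by gcongr
        have a2 : (1 + κ) * p * ψ ≤ (1 + κ) * p * (L ^ (p - 1) / ‖y‖ ^ 2) := by gcongr
        have a3 : A / ‖y‖ ^ 2 = (1 + κ) * p * (L ^ (p - 1) / ‖y‖ ^ 2) := by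
          rw [hAd, S.hA]; ring
        have a4 : κ * (p * u) + p * ψ ≤ A / ‖y‖ ^ 2 := by rw [a3]; linarith
        have := mul_le_mul_of_nonneg_right a4 hz1pos.le
        linarith
      have hG : 0 < F * D * (A' - A) * (Y / ‖y‖ ^ 2) := by positivity
      have h7 : p * ψ * z2 - p * u * (K * z2) < F * D * (A' - A) * (Y / ‖y‖ ^ 2) := by
        rcases le_or_gt R1 ‖y‖ with h | h
        · have b1 := hfar y h s ⟨hs.1.le, hs.2⟩
          have b2 : c * φ ‖y‖ ≤ v y s :=
            (mul_le_mul_of_nonneg_left (S.φle _ hy') hc.le).trans b1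
          have b3 := Real.rpow_le_rpow (by positivity) b2 (show 0 ≤ p - 1 by linarith)
          rw [Real.mul_rpow hc.le hφ.le, ← hψ, ← hu] at b3
          have b4 : ψ ≤ K * u := by
            calc ψ = K * (c ^ (p - 1) * ψ) := by rw [← mul_assoc, hKc, one_mul]
              _ ≤ K * u := mul_le_mul_of_nonneg_left b3 hKpos.le
          have b5 : p * z2 * ψ ≤ p * z2 * (K * u) :=
            mul_le_mul_of_nonneg_left b4 (by positivity)
          linarith
        · have b1 : p * ψ * z2 ≤ p * α ^ (p - 1) * (Real.exp (K * τ) * ε) := by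
            have : E ≤ Real.exp (K * τ) :=
              Real.exp_le_exp.2 (mul_le_mul_of_nonneg_left hs.2 hKpos.le)
            rw [hz2]; gcongr
          have b2 : p * α ^ (p - 1) * (Real.exp (K * τ) * ε) < rhs := by
            rw [hε0, lt_div_iff₀ (by positivity)] at hεε
            linarith
          have b3 : rhs ≤ F * D * (A' - A) * (Y / ‖y‖ ^ 2) := by
            have c1 : Real.exp (-κ * τ) ≤ F := by
              apply Real.exp_le_exp.2
              nlinarith [hs.2]
            have c2 : R1 ^ (-γ') ≤ Y := rpow_ne_le hy' h.le hγ0'.le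
            rw [hrhs]; gcongr
          have b4 : 0 ≤ p * u * (K * z2) := by positivity
          linarith
      have e1 : F * (-D * (-A * (X / ‖y‖ ^ 2) + -A' * (Y / ‖y‖ ^ 2))) =
          A / ‖y‖ ^ 2 * z1 + F * D * (A' - A) * (Y / ‖y‖ ^ 2) := by
        rw [hz1]; ring
      rw [e1]
      have e2 : p * u * (-κ * (F * (-D * (X + Y))) + K * (E * -ε)) =
          κ * (p * u) * z1 - p * u * (K * z2) := by rw [hz1, hz2]; ring
      rw [e2]
      linarith
  refine le_of_forall_pos_le_add fun δ hδ => ?_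
  have hE : 0 < Real.exp (K * t) := Real.exp_pos _
  have := key (min (ε0 / 2) (δ / Real.exp (K * t))) (by positivity)
    ((min_le_left _ _).trans_lt (by linarith))
  have h2 : min (ε0 / 2) (δ / Real.exp (K * t)) * Real.exp (K * t) ≤ δ := by
    rw [← le_div_iff₀ hE]; exact min_le_right _ _
  linarith

/-- S6 iterated -/
lemma step6_iter {n : ℕ} {p ν L γ κ : ℝ} {φ : ℝ → ℝ} (S : Setup n p ν L γ κ φ)
    {γ' : ℝ} (hγ' : γ < γ') (hγ2 : γ' < ((n:ℝ) - 2) / 2)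
    {v : EE n → ℝ → ℝ} {v₀ : EE n → ℝ} (hv : IsBddClassicalSol n p v v₀) {D : ℝ} (hD : 0 < D)
    (h0 : ∀ x : EE n, x ≠ 0 → φ ‖x‖ - D * (‖x‖ ^ (-γ) + ‖x‖ ^ (-γ')) ≤ v₀ x) :
    ∀ x : EE n, x ≠ 0 → ∀ t ≥ 0,
      φ ‖x‖ - Real.exp (-κ * t) * (D * (‖x‖ ^ (-γ) + ‖x‖ ^ (-γ'))) ≤ v x t := by
  obtain ⟨τ, hτ, hs⟩ := step6 S hγ' hγ2
  have hind : ∀ k : ℕ, ∀ x : EE n, x ≠ 0 → ∀ t ∈ Icc 0 (k * τ),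
      φ ‖x‖ - Real.exp (-κ * t) * (D * (‖x‖ ^ (-γ) + ‖x‖ ^ (-γ'))) ≤ v x t := by
    intro k
    induction k with
    | zero =>
      intro x hx t ht
      have : t = 0 := by
        have := ht.2
        simp only [Nat.cast_zero, zero_mul] at this
        exact le_antisymm this ht.1
      subst this
      rw [hv.init]
      simpa using h0 x hx
    | succ k ih =>
      intro x hx t ht
      have hkτ : 0 ≤ k * τ := by positivity
      rcases le_total t (k * τ) with h | h
      · exact ih x hx t ⟨ht.1, h⟩
      · have := hs _ _ (time_shift hv hkτ) (Real.exp (-κ * (k * τ)) * D) (by positivity)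
          (fun y hy => by
            have := ih y hy (k * τ) ⟨hkτ, le_rfl⟩
            linarith) x hx (t - k * τ) ⟨by linarith, by
              have := ht.2
              push_cast at this
              linarith⟩
        have e : (k:ℝ) * τ + (t - k * τ) = t := by ring
        have e2 : Real.exp (-κ * t) = Real.exp (-κ * (t - k * τ)) * Real.exp (-κ * (k * τ)) := by
          rw [← Real.exp_add]; ring_nf
        beta_reduce at this
        rw [e] at this
        rw [e2]
        linarith
  intro x hx t ht
  obtain ⟨k, hk⟩ := exists_nat_ge (t / τ)
  rw [div_le_iff₀ hτ] at hk
  exact hind k x hx t ⟨ht, hk⟩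

set_option maxHeartbeats 1000000 in
/-- S7, lower bound in a ball -/
lemma step7 {n : ℕ} {p ν L γ κ : ℝ} {φ : ℝ → ℝ} (S : Setup n p ν L γ κ φ)
    {v : EE n → ℝ → ℝ} {v₀ : EE n → ℝ} (hv : IsBddClassicalSol n p v v₀)
    {γ' : ℝ} (hγ' : 0 < γ') {D : ℝ} (hD : 0 < D)
    (h2 : ∀ x : EE n, x ≠ 0 → ∀ t ≥ 0,
      φ ‖x‖ - Real.exp (-κ * t) * (D * (‖x‖ ^ (-γ) + ‖x‖ ^ (-γ'))) ≤ v x t) :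
    ∃ C > 0, ∀ x : EE n, x ≠ 0 → ∀ t ≥ 0, φ ‖x‖ - C * Real.exp (-κ * t) ≤ v x t := by
  have hL := S.hL
  have hp := S.hp
  have hκ := S.hκ
  have hγ0 : 0 < γ := S.hν.trans S.hγ
  have hn : (10 : ℝ) < n := by exact_mod_cast S.hn
  obtain ⟨M, hM, hφM⟩ := S.φbd
  set q : ℝ := (1 + κ) * (p * M ^ (p - 1)) with hq
  have hqpos : 0 < q := by positivity
  obtain ⟨ρ, hρ, hρq⟩ : ∃ ρ > 0, q * (2 * ρ) ^ 2 ≤ 1 / 2 := by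
    refine ⟨min 1 (1 / (8 * q)), by positivity, ?_⟩
    set ρ := min 1 (1 / (8 * q))
    have a1 : 0 < ρ := by positivity
    have a2 : ρ ≤ 1 := min_le_left _ _
    have a3 : ρ ≤ 1 / (8 * q) := min_le_right _ _
    rw [le_div_iff₀ (by positivity)] at a3
    nlinarith
  set C : ℝ := 2 * (D * (ρ ^ (-γ) + ρ ^ (-γ')) + M) with hC
  have hCpos : 0 < C := by positivity
  refine ⟨C, hCpos, fun x hx t ht => ?_⟩
  have hx' : 0 < ‖x‖ := by simpa using hx
  have hbig : ∀ y : EE n, ρ ≤ ‖y‖ → D * (‖y‖ ^ (-γ) + ‖y‖ ^ (-γ')) < C / 2 := by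
    intro y hy
    have a1 := rpow_ne_le hρ hy hγ0.le
    have a2 := rpow_ne_le hρ hy hγ'.le
    have := mul_le_mul_of_nonneg_left (add_le_add a1 a2) hD.le
    rw [hC]; linarith
  rcases le_or_gt ρ ‖x‖ with hxr | hxr
  · have a1 := h2 x hx t ht
    have a2 := hbig x hxr
    have a3 := mul_le_mul_of_nonneg_left
      (show D * (‖x‖ ^ (-γ) + ‖x‖ ^ (-γ')) ≤ C by linarith)
      (Real.exp_pos (-κ * t)).le
    linarith
  have key : ∀ ε > 0, φ ‖x‖ - C * Real.exp (-κ * t) ≤ v x t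
      + ε * (Real.exp (-κ * t) * ‖x‖ ^ (-γ)) := by
    intro ε hε
    obtain ⟨c, hc, hc1, hcM⟩ := ptail_small (M := M) hγ0
      (show 0 < Real.exp (-κ * t) * ε by positivity)
    have R1 := (((radLap_const n 1).add ((radLap_sq n).mul (-q))).mul (-C))
    have hg : ∀ y : EE n, ‖y‖ ∈ Ioo 0 (2 * ρ) → C / 2 ≤ C * (1 + -q * ‖y‖ ^ 2) := by
      intro y hy
      have : ‖y‖ ^ 2 ≤ (2 * ρ) ^ 2 := pow_le_pow_left₀ hy.1.le hy.2.le 2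
      have h3 : q * ‖y‖ ^ 2 ≤ 1 / 2 := (mul_le_mul_of_nonneg_left this hqpos.le).trans hρq
      have h4 := mul_le_mul_of_nonneg_left h3 hCpos.le
      linarith
    have := cmp_lower hp hv (T := t) isOpen_Ioo
      (fun r hr => hr.1 : Ioo (0:ℝ) (2 * ρ) ⊆ Ioi 0) c ρ
      (fun r hr => ⟨lt_of_lt_of_le hc hr.1, by linarith [hr.2]⟩) S.Rφ R1
      ((radLap_pow n γ).mul (-ε)) (-κ) (-κ) ?_ ?_ ?_ x ⟨hx', by linarith⟩ t
      ⟨ht, le_refl _⟩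
    · have e1 : C * (1 + -q * ‖x‖ ^ 2) ≤ C := by
        have := mul_nonneg (mul_pos hCpos hqpos).le (sq_nonneg ‖x‖)
        linarith
      have e2 := mul_le_mul_of_nonneg_left e1 (Real.exp_pos (-κ * t)).le
      linarith
    · intro y hy
      have hy0 : y ≠ 0 := by simpa using hy.1.ne'
      have hy1 := hy.1
      have := hg y hy
      have a1 := hv.nonneg y 0 le_rfl
      rw [hv.init] at a1
      have a2 : M < C / 2 := by
        have : 0 < D * (ρ ^ (-γ) + ρ ^ (-γ')) := by positivity
        rw [hC]; linarith
      have a3 : 0 < ε * ‖y‖ ^ (-γ) := by positivity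
      have a4 := hφM _ hy.1
      linarith
    · intro y hy hyK s hs
      have hy' : 0 < ‖y‖ := hy.1
      have hy0 : y ≠ 0 := by simpa using hy.1.ne'
      have hv0 := hv.nonneg y s hs.1
      have hφ := hφM _ hy'
      have hg1 := hg y hy
      have a3 : 0 < Real.exp (-κ * s) * (ε * ‖y‖ ^ (-γ)) := by positivity
      have a4 : Real.exp (-κ * s) * (C / 2) ≤ Real.exp (-κ * s) * (C * (1 + -q * ‖y‖ ^ 2)) :=
        mul_le_mul_of_nonneg_left hg1 (Real.exp_pos _).le
      have a5 : 0 < Real.exp (-κ * s) * (C / 2) := by positivity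
      rcases lt_or_ge ‖y‖ c with h | h
      · have := hcM _ hy' h
        have hz3 : Real.exp (-κ * t) * ε * ‖y‖ ^ (-γ) ≤ Real.exp (-κ * s) * (ε * ‖y‖ ^ (-γ)) := by
          rw [mul_assoc]
          apply mul_le_mul_of_nonneg_right _ (by positivity)
          apply Real.exp_le_exp.2
          nlinarith [hs.2]
        linarith
      · have hd' : ρ < ‖y‖ := by
          by_contra hh
          exact hyK ⟨h, not_lt.1 hh⟩
        have b1 := h2 y hy0 s hs.1
        have b2 := mul_lt_mul_of_pos_left (hbig y hd'.le) (Real.exp_pos (-κ * s))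
        linarith
    · intro y hy s hs hveq
      have hy' : 0 < ‖y‖ := hy.1
      have hφ := S.φpos _ hy'
      have hv0 := hv.nonneg y s hs.1.le
      have hg1 := hg y hy
      beta_reduce at hveq ⊢
      set E := Real.exp (-κ * s) with hE
      have hEpos : 0 < E := Real.exp_pos _
      set z := E * (C * (1 + -q * ‖y‖ ^ 2)) with hz
      have hzpos : 0 < z := by
        apply mul_pos hEpos; linarith
      have hzC : z ≤ E * C := by
        apply mul_le_mul_of_nonneg_left _ hEpos.le
        have := mul_nonneg (mul_pos hCpos hqpos).le (sq_nonneg ‖y‖)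
        linarith
      set z1 := E * (ε * ‖y‖ ^ (-γ)) with hz1
      have hz1pos : 0 < z1 := by positivity
      have hvz : φ ‖y‖ - v y s = z + z1 := by rw [hveq]; ring
      have hcv := convex_bound (p := p) hp.le hv0 (a := φ ‖y‖) (by linarith)
      rw [hvz] at hcv
      set ψ := φ ‖y‖ ^ (p - 1) with hψ
      set u := v y s ^ (p - 1) with hu
      have hu0 : 0 ≤ u := Real.rpow_nonneg hv0 _
      have huψ : u ≤ ψ := Real.rpow_le_rpow hv0 (by linarith) (by linarith)
      have hψL : ψ ≤ L ^ (p - 1) / ‖y‖ ^ 2 := by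
        rw [← Phi_pow S.hνp hL hy']
        exact Real.rpow_le_rpow hφ.le (S.φle _ hy') (by linarith)
      have hψα : ψ ≤ M ^ (p - 1) := Real.rpow_le_rpow hφ.le (hφM _ hy') (by linarith)
      have hψ0 : 0 ≤ ψ := hu0.trans huψ
      have h5 : (1 + κ) * (p * ψ) * z ≤ q * (E * C) := by
        have : (1 + κ) * (p * ψ) ≤ q := by
          rw [hq]; gcongr
        exact mul_le_mul this hzC hzpos.le hqpos.le
      have h5' : q * (E * C) < q * (E * C) * (2 * n) := by
        have h1 : 0 < q * (E * C) := by positivity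
        have h2 := mul_pos h1 (show (0:ℝ) < 2 * n - 1 by linarith)
        linarith
      have h6 : (1 + κ) * (p * ψ) * z1 ≤
          γ * ((n : ℝ) - 2 - γ) / ‖y‖ ^ 2 * z1 := by
        apply mul_le_mul_of_nonneg_right _ hz1pos.le
        rw [S.hA]
        have : (1 + κ) * (p * L ^ (p - 1)) / ‖y‖ ^ 2 = (1 + κ) * p * (L ^ (p - 1) / ‖y‖ ^ 2) := by
          ring
        rw [this]
        have := mul_le_mul_of_nonneg_left hψL (show 0 ≤ (1 + κ) * p by positivity)
        linarith
      have h9 : κ * (p * u) * (z + z1) ≤ κ * (p * ψ) * (z + z1) := by gcongr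
      have h7 : E * (-ε * (-(γ * ((n : ℝ) - 2 - γ)) * (‖y‖ ^ (-γ) / ‖y‖ ^ 2))) =
          γ * ((n : ℝ) - 2 - γ) / ‖y‖ ^ 2 * z1 := by rw [hz1]; ring
      rw [h7]
      have h8 : E * (-C * (0 + -q * (2 * n))) = q * (E * C) * (2 * n) := by ring
      rw [h8]
      have h10 : p * u * (-κ * (E * (-C * (1 + -q * ‖y‖ ^ 2))) + -κ * (E * (-ε * ‖y‖ ^ (-γ)))) =
          κ * (p * u) * (z + z1) := by rw [hz, hz1]; ring
      rw [h10]
      linarith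
  have hc : 0 < Real.exp (-κ * t) * ‖x‖ ^ (-γ) := by positivity
  refine le_of_forall_pos_le_add fun δ hδ => ?_
  have := key (δ / (Real.exp (-κ * t) * ‖x‖ ^ (-γ))) (by positivity)
  rwa [div_mul_cancel₀ _ hc.ne'] at this

/-- Theorem 1.1: let `n > 10`, `p > p_c`, `α > 0`, and let `v₀` be continuous
with `0 ≤ v₀(x) ≤ L|x|^{−ν}` for `x ≠ 0` and `|v₀(x) − φ_α(|x|)| ≤ b|x|^{−γ}` for `|x| > 1`,
where `b > 0` and `γ ∈ (ν+λ₁, (n−2)/2)`. Then every bounded classical solution `v` with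
initial data `v₀` satisfies `|v(x,t) − φ_α(|x|)| ≤ C e^{−κ(γ)t}` for some `C > 0`. -/
theorem convergence_rate_full_space (n : ℕ) (hn : 10 < n) (p α b γ : ℝ)
    (hp : pc n < p) (hα : 0 < α) (hb : 0 < b)
    (hγ : γ ∈ Set.Ioo (nuExp p + lam1 n p) (((n : ℝ) - 2) / 2))
    (φ : ℝ → ℝ) (a : ℝ) (hφ : IsSteadyStateA n p α φ a)
    (v₀ : EuclideanSpace ℝ (Fin n) → ℝ) (hv₀cont : Continuous v₀)
    (hv₀nonneg : ∀ x, 0 ≤ v₀ x)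
    (hv₀upper : ∀ x : EuclideanSpace ℝ (Fin n), x ≠ 0 →
      v₀ x ≤ Lconst n p * ‖x‖ ^ (-nuExp p))
    (hv₀close : ∀ x : EuclideanSpace ℝ (Fin n), 1 < ‖x‖ →
      |v₀ x - φ ‖x‖| ≤ b * ‖x‖ ^ (-γ))
    (v : EuclideanSpace ℝ (Fin n) → ℝ → ℝ) (hv : IsBddClassicalSol n p v v₀) :
    ∃ C > 0, ∀ x, ∀ t ≥ (0 : ℝ),
      |v x t - φ ‖x‖| ≤ C * Real.exp (-(kappaOf n p γ) * t) := by
  have S := setup_of n hn p α γ hp hα hγ φ a hφ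
  obtain ⟨κ, hκd⟩ : ∃ κ, κ = kappaOf n p γ := ⟨_, rfl⟩
  obtain ⟨ν, hνd⟩ : ∃ ν, ν = nuExp p := ⟨_, rfl⟩
  obtain ⟨L, hLd⟩ : ∃ L, L = Lconst n p := ⟨_, rfl⟩
  rw [← hκd, ← hνd, ← hLd] at S
  rw [← hνd, ← hLd] at hv₀upper
  rw [← hκd]
  have hγ0 : 0 < γ := S.hν.trans S.hγ
  have hκ := S.hκ
  obtain ⟨M, hM⟩ := hv.bdd 1 one_pos
  have hM0 : 0 ≤ M := (hv.nonneg 0 0 le_rfl).trans (hM 0 0 ⟨le_rfl, zero_le_one⟩)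
  obtain ⟨α', hα', hφα⟩ := S.φbd
  have hB : 0 < b + M := by linarith
  have hD : 0 < b + α' := by linarith
  have hΦv := step1 S hv hv₀upper
  have h0u : ∀ x : EE n, x ≠ 0 → v₀ x ≤ φ ‖x‖ + (b + M) * ‖x‖ ^ (-γ) := by
    intro x hx
    have hx' : 0 < ‖x‖ := by simpa using hx
    have hr : 0 < ‖x‖ ^ (-γ) := by positivity
    rcases le_or_gt ‖x‖ 1 with h | h
    · have h1 := rpow_ne_one_le hx' h hγ0.le
      have h2 := hM x 0 ⟨le_rfl, zero_le_one⟩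
      rw [hv.init] at h2
      have h3 := S.φpos _ hx'
      have h4 := mul_le_mul_of_nonneg_left h1 hM0
      have h5 := mul_pos hb hr
      linarith
    · have h1 := (abs_le.1 (hv₀close x h)).2
      have h2 := mul_nonneg hM0 hr.le
      linarith
  have hup := step2 S hv hΦv hB h0u
  have hup' : ∀ x : EE n, x ≠ 0 → ∀ t ≥ 0, v x t ≤ φ ‖x‖ + (b + M) * ‖x‖ ^ (-γ) := by
    intro x hx t ht
    have hx' : 0 < ‖x‖ := by simpa using hx
    have h1 : Real.exp (-κ * t) ≤ 1 := Real.exp_le_one_iff.2 (by nlinarith)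
    have h2 : 0 < (b + M) * ‖x‖ ^ (-γ) := by positivity
    have h3 := mul_le_mul_of_nonneg_right h1 h2.le
    linarith [hup x hx t ht]
  obtain ⟨M', hM', hvM'⟩ := step3 S hv hΦv hB hup'
  obtain ⟨C1, hC1, hC1'⟩ := step4 S hv hΦv hB hup hM' hvM'
  obtain ⟨γ', hγ1, hγ2⟩ := exists_between S.hγ2
  have h0l : ∀ x : EE n, x ≠ 0 →
      φ ‖x‖ - (b + α') * (‖x‖ ^ (-γ) + ‖x‖ ^ (-γ')) ≤ v₀ x := by
    intro x hx
    have hx' : 0 < ‖x‖ := by simpa using hx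
    have hr : 0 < ‖x‖ ^ (-γ) := by positivity
    have hr' : 0 < ‖x‖ ^ (-γ') := by positivity
    have h6 := mul_pos hD hr'
    have h7 := mul_pos hb hr
    rcases le_or_gt ‖x‖ 1 with h | h
    · have h1 := rpow_ne_one_le hx' h hγ0.le
      have h2 := hv₀nonneg x
      have h3 := hφα _ hx'
      have h4 := mul_le_mul_of_nonneg_left h1 hα'.le
      linarith
    · have h1 := (abs_le.1 (hv₀close x h)).1
      have h2 := mul_pos hα' hr
      linarith
  have hlow := step6_iter S hγ1 hγ2 hv hD h0l
  obtain ⟨C2, hC2, hC2'⟩ := step7 S hv (hγ0.trans hγ1) hD hlow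
  refine ⟨C1 + C2, by positivity, fun x t ht => ?_⟩
  have hne : ∀ y : EE n, y ≠ 0 → |v y t - φ ‖y‖| ≤ (C1 + C2) * Real.exp (-κ * t) := by
    intro y hy
    have h1 := hC1' y hy t ht
    have h2 := hC2' y hy t ht
    have h3 := mul_pos hC1 (Real.exp_pos (-κ * t))
    have h4 := mul_pos hC2 (Real.exp_pos (-κ * t))
    rw [abs_le]
    constructor <;> linarith
  have hcont : Continuous (fun y : EE n => |v y t - φ ‖y‖|) := by
    have h1 : Continuous (fun y : EE n => v y t) :=
      hv.cont.comp_continuous (f := fun y : EE n => (y, t)) (by fun_prop)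
        (fun y => ⟨mem_univ _, ht⟩)
    have h2 : Continuous (fun y : EE n => φ ‖y‖) :=
      hφ.cont.comp_continuous continuous_norm (fun y => norm_nonneg y)
    exact (h1.sub h2).abs
  have hclosed : IsClosed {y : EE n | |v y t - φ ‖y‖| ≤ (C1 + C2) * Real.exp (-κ * t)} :=
    isClosed_le hcont continuous_const
  haveI : Nonempty (Fin n) := ⟨⟨0, by omega⟩⟩
  haveI : Nontrivial (EE n) := inferInstance
  haveI : (nhdsWithin (0 : EE n) {0}ᶜ).NeBot := Module.punctured_nhds_neBot ℝ (EE n) 0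
  have hd : Dense ({0}ᶜ : Set (EE n)) := dense_compl_singleton 0
  have hsub : ({0}ᶜ : Set (EE n)) ⊆ {y : EE n | |v y t - φ ‖y‖| ≤ (C1 + C2) * Real.exp (-κ * t)} :=
    fun y hy => hne y hy
  have := hclosed.closure_subset_iff.2 hsub
  rw [hd.closure_eq] at this
  exact this (mem_univ x)
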